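/- For every μ > 0 and every pair w₁, w₂ ∈ C_c^∞(B_R) that are linearly independent, one has sup { R_μ(w) : w a nonzero linear combination of w₁ and w₂ } ≥ (d + 2) μ. Consequently, any Dirichlet eigenvalue ν of −Δ + μ²‖x‖² on B_R distinct from the smallest one satisfies ν − d·μ ≥ 2μ. -/

import Mathlib

open MeasureTheory Metric Set Filter

/-- The Rayleigh quotient of the operator `−Δ + μ²‖x‖²` on the ball `B_R`. -/
noncomputable def rayleigh (n : ℕ) (R μ : ℝ) (w : EuclideanSpace ℝ (Fin n) → ℝ) : ℝ :=
  (∫ x in ball (0 : EuclideanSpace ℝ (Fin n)) R,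
      (‖gradient w x‖ ^ 2 + μ ^ 2 * ‖x‖ ^ 2 * (w x) ^ 2)) /
  (∫ x in ball (0 : EuclideanSpace ℝ (Fin n)) R, (w x) ^ 2)

/-- `w` belongs to `C_c^∞(B_R)`: smooth, compactly supported, with support inside `B_R`. -/
def IsTestFun (n : ℕ) (R : ℝ) (w : EuclideanSpace ℝ (Fin n) → ℝ) : Prop :=
  ContDiff ℝ (⊤ : ℕ∞) w ∧ HasCompactSupport w ∧
    tsupport w ⊆ ball (0 : EuclideanSpace ℝ (Fin n)) R

/-- The bottom `ν_μ` of the Rayleigh quotient (the smallest Dirichlet eigenvalue of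
`−Δ + μ²‖x‖²` on `B_R`). -/
noncomputable def nuBottom (n : ℕ) (R μ : ℝ) : ℝ :=
  sInf {ν : ℝ | ∃ w : EuclideanSpace ℝ (Fin n) → ℝ,
    IsTestFun n R w ∧ w ≠ 0 ∧ ν = rayleigh n R μ w}

/-- The Euclidean Laplacian of `f : ℝ^n → ℝ` at `x`. -/
noncomputable def lapl {n : ℕ} (f : EuclideanSpace ℝ (Fin n) → ℝ)
    (x : EuclideanSpace ℝ (Fin n)) : ℝ :=
  ∑ i, fderiv ℝ (fun z => fderiv ℝ f z (EuclideanSpace.single i 1)) x (EuclideanSpace.single i 1)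

/-- `ν` is a Dirichlet eigenvalue of `−Δ + μ²‖x‖²` on `B_R`. -/
def IsDirichletEigenvalue (n : ℕ) (R μ ν : ℝ) : Prop :=
  ∃ φ : EuclideanSpace ℝ (Fin n) → ℝ,
    ContinuousOn φ (closedBall (0 : EuclideanSpace ℝ (Fin n)) R) ∧
    ContDiffOn ℝ (⊤ : ℕ∞) φ (ball (0 : EuclideanSpace ℝ (Fin n)) R) ∧
    (∃ x ∈ ball (0 : EuclideanSpace ℝ (Fin n)) R, φ x ≠ 0) ∧
    (∀ x ∈ sphere (0 : EuclideanSpace ℝ (Fin n)) R, φ x = 0) ∧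
    ∀ x ∈ ball (0 : EuclideanSpace ℝ (Fin n)) R,
      -lapl φ x + μ ^ 2 * ‖x‖ ^ 2 * φ x = ν * φ x

section PlaneRotation

variable {E : Type*} [NormedAddCommGroup E] [InnerProductSpace ℝ E]

/-- The rotation `(x, y) ↦ (c x - s y, s x + c y)` of `E × E`. -/
def planeRotation (E : Type*) [AddCommGroup E] [Module ℝ E] (c s : ℝ) : E × E →ₗ[ℝ] E × E where
  toFun p := (c • p.1 - s • p.2, s • p.1 + c • p.2)
  map_add' p q := by
    ext <;> simp <;> module
  map_smul' a p := by
    ext <;> simp <;> module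

lemma abs_det_planeRotation {c s : ℝ} (h : c ^ 2 + s ^ 2 = 1) :
    |LinearMap.det (planeRotation E c s)| = 1 := by
  let S : (E × E) ≃ₗ[ℝ] (E × E) :=
    (LinearEquiv.refl ℝ E).prodCongr (LinearEquiv.neg ℝ)
  have hconj : (S : E × E →ₗ[ℝ] E × E) ∘ₗ planeRotation E c s ∘ₗ (S.symm : E × E →ₗ[ℝ] E × E)
      = planeRotation E c (-s) := by
    ext p <;> simp [S, planeRotation]
  have hcomp : planeRotation E c (-s) ∘ₗ planeRotation E c s = LinearMap.id := by
    have key : ∀ x : E, (c * c) • x + (s * s) • x = x := fun x => by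
      rw [← add_smul, ← sq, ← sq, h, one_smul]
    ext p <;> simp [planeRotation, smul_smul, mul_comm, key, add_comm]
  have hdet := congrArg LinearMap.det hcomp
  rw [LinearMap.det_comp, ← hconj, LinearMap.det_conj, LinearMap.det_id] at hdet
  exact abs_eq_abs.mpr (mul_self_eq_one_iff.mp hdet) |>.trans abs_one

lemma norm_sq_planeRotation {c s : ℝ} (h : c ^ 2 + s ^ 2 = 1) (x y : E) :
    ‖c • x - s • y‖ ^ 2 + ‖s • x + c • y‖ ^ 2 = ‖x‖ ^ 2 + ‖y‖ ^ 2 := by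
  rw [norm_sub_sq_real, norm_add_sq_real]
  simp only [norm_smul, mul_pow, Real.norm_eq_abs, sq_abs, inner_smul_left, inner_smul_right,
    RCLike.conj_to_real]
  linear_combination (‖x‖ ^ 2 + ‖y‖ ^ 2) * h

lemma gaussian_mul_planeRotation {c s : ℝ} (h : c ^ 2 + s ^ 2 = 1) (μ : ℝ) (x y : E) :
    Real.exp (-μ * ‖c • x - s • y‖ ^ 2) * Real.exp (-μ * ‖s • x + c • y‖ ^ 2)
      = Real.exp (-μ * ‖x‖ ^ 2) * Real.exp (-μ * ‖y‖ ^ 2) := by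
  rw [← Real.exp_add, ← Real.exp_add, ← mul_add, ← mul_add, norm_sq_planeRotation h]

lemma hasFDerivAt_gaussian (μ : ℝ) (x : E) :
    HasFDerivAt (fun x : E => Real.exp (-μ * ‖x‖ ^ 2))
      ((-2 * μ * Real.exp (-μ * ‖x‖ ^ 2)) • innerSL ℝ x) x := by
  have h := (((hasStrictFDerivAt_norm_sq x).hasFDerivAt).const_mul (-μ)).exp
  convert h using 1
  ext v
  simp
  ring

end PlaneRotation

section GaussianPoincare

variable {E : Type*} [NormedAddCommGroup E] [InnerProductSpace ℝ E] [FiniteDimensional ℝ E]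
  [MeasurableSpace E] [BorelSpace E]

lemma integrable_gaussian {μ : ℝ} (hμ : 0 < μ) :
    Integrable fun x : E => Real.exp (-μ * ‖x‖ ^ 2) := by
  have h := (GaussianFourier.integrable_cexp_neg_mul_sq_norm_add (V := E) (b := (μ : ℂ))
    (by simpa using hμ) 0 0).norm
  refine h.congr (Eventually.of_forall fun x => ?_)
  simp only [Complex.norm_exp, zero_mul, add_zero]
  norm_cast

lemma integrable_norm_mul_gaussian {μ : ℝ} (hμ : 0 < μ) :
    Integrable fun x : E => ‖x‖ * Real.exp (-μ * ‖x‖ ^ 2) := by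
  have h := (integrable_gaussian (E := E) (half_pos hμ)).const_mul (1 + 2 / μ)
  refine h.mono' (by fun_prop) (Eventually.of_forall fun x => ?_)
  have hsplit : Real.exp (-μ * ‖x‖ ^ 2)
      = Real.exp (-(μ / 2) * ‖x‖ ^ 2) * Real.exp (-(μ / 2) * ‖x‖ ^ 2) := by
    rw [← Real.exp_add]; ring_nf
  have hinv : Real.exp (μ / 2 * ‖x‖ ^ 2) * Real.exp (-(μ / 2) * ‖x‖ ^ 2) = 1 := by
    rw [← Real.exp_add]; simp
  have hlin := Real.add_one_le_exp (μ / 2 * ‖x‖ ^ 2)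
  have hle : ‖x‖ ≤ (1 + 2 / μ) * Real.exp (μ / 2 * ‖x‖ ^ 2) := by
    have h1 : 2 / μ * (μ / 2 * ‖x‖ ^ 2) = ‖x‖ ^ 2 := by field_simp
    have h2 : (0 : ℝ) < 2 / μ := by positivity
    have h3 : 0 ≤ μ / 2 * ‖x‖ ^ 2 := by positivity
    nlinarith [sq_nonneg (‖x‖ - 1), mul_le_mul_of_nonneg_left hlin h2.le]
  have hpos := Real.exp_pos (-(μ / 2) * ‖x‖ ^ 2)
  rw [Real.norm_of_nonneg (by positivity), hsplit]
  calc ‖x‖ * (Real.exp (-(μ / 2) * ‖x‖ ^ 2) * Real.exp (-(μ / 2) * ‖x‖ ^ 2))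
      ≤ (1 + 2 / μ) * Real.exp (μ / 2 * ‖x‖ ^ 2) *
        (Real.exp (-(μ / 2) * ‖x‖ ^ 2) * Real.exp (-(μ / 2) * ‖x‖ ^ 2)) := by gcongr
    _ = (1 + 2 / μ) * (Real.exp (μ / 2 * ‖x‖ ^ 2) * Real.exp (-(μ / 2) * ‖x‖ ^ 2)) *
        Real.exp (-(μ / 2) * ‖x‖ ^ 2) := by ring
    _ = _ := by rw [hinv, mul_one]

lemma integral_comp_planeRotation {c s : ℝ} (h : c ^ 2 + s ^ 2 = 1) {F : E × E → ℝ}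
    (hF : Continuous F) :
    ∫ p : E × E, F (c • p.1 - s • p.2, s • p.1 + c • p.2) = ∫ p, F p := by
  have habs := abs_det_planeRotation (E := E) h
  have : (volume : Measure (E × E)).IsAddHaarMeasure :=
    inferInstanceAs (((volume : Measure E).prod volume).IsAddHaarMeasure)
  have hmap : Measure.map (planeRotation E c s) (volume : Measure (E × E)) = volume := by
    rw [Measure.map_linearMap_addHaar_eq_smul_addHaar _ (fun h0 => by simp [h0] at habs),
      abs_inv, habs]
    simp
  have := integral_map (μ := (volume : Measure (E × E))) (φ := planeRotation E c s)
    (LinearMap.continuous_of_finiteDimensional _).aemeasurable (f := F)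
    hF.aestronglyMeasurable
  rw [hmap] at this
  exact this.symm

end GaussianPoincare
section GaussianPoincare

variable {E : Type*} [NormedAddCommGroup E] [InnerProductSpace ℝ E] [FiniteDimensional ℝ E]
  [MeasurableSpace E] [BorelSpace E]

lemma integrable_gaussian_prod {μ : ℝ} (hμ : 0 < μ) :
    Integrable fun p : E × E => Real.exp (-μ * ‖p.1‖ ^ 2) * Real.exp (-μ * ‖p.2‖ ^ 2) :=
  (integrable_gaussian (E := E) hμ).mul_prod (integrable_gaussian (E := E) hμ)

lemma integrable_norm_add_mul_gaussian_prod {μ : ℝ} (hμ : 0 < μ) :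
    Integrable fun p : E × E => (‖p.1‖ + ‖p.2‖) *
      (Real.exp (-μ * ‖p.1‖ ^ 2) * Real.exp (-μ * ‖p.2‖ ^ 2)) := by
  have h1 := (integrable_norm_mul_gaussian (E := E) hμ).mul_prod (integrable_gaussian (E := E) hμ)
  have h2 := (integrable_gaussian (E := E) hμ).mul_prod (integrable_norm_mul_gaussian (E := E) hμ)
  refine (h1.add h2).congr (Eventually.of_forall fun p => ?_)
  simp only [Pi.add_apply]
  ring

/-- Gaussian integration by parts, along the affine map `y ↦ x - s y`. -/
lemma integral_mul_inner_mul_gaussian {μ : ℝ} (hμ : 0 < μ) {f : E → ℝ} (hf : ContDiff ℝ 1 f)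
    (hfc : HasCompactSupport f) (x v : E) (s : ℝ) :
    2 * μ * ∫ y, f (x - s • y) * inner ℝ y v * Real.exp (-μ * ‖y‖ ^ 2)
      = -s * ∫ y, fderiv ℝ f (x - s • y) v * Real.exp (-μ * ‖y‖ ^ 2) := by
  obtain ⟨M, hM⟩ := hfc.exists_bound_of_continuous hf.continuous
  have hf' : Continuous (fderiv ℝ f) := hf.continuous_fderiv one_ne_zero
  obtain ⟨L, hL⟩ := (hfc.fderiv ℝ).exists_bound_of_continuous hf'
  have hd : ∀ y, HasFDerivAt (fun y => f (x - s • y)) (-s • fderiv ℝ f (x - s • y)) y := by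
    intro y
    have h1 : HasFDerivAt (fun y : E => x - s • y) (-(s • ContinuousLinearMap.id ℝ E)) y :=
      ((hasFDerivAt_id y).const_smul s).const_sub x
    refine (((hf.differentiable one_ne_zero (x - s • y)).hasFDerivAt).comp y h1).congr_fderiv ?_
    ext v
    simp
  have hL' : ∀ y, ‖fderiv ℝ f (x - s • y) v‖ ≤ L * ‖v‖ := fun y =>
    ((fderiv ℝ f (x - s • y)).le_opNorm v).trans (by gcongr; exact hL _)
  have hG := integrable_gaussian (E := E) hμ
  have hfG : Integrable fun y => f (x - s • y) * Real.exp (-μ * ‖y‖ ^ 2) :=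
    hG.bdd_mul (c := M) (by have := hf.continuous; fun_prop) (Eventually.of_forall fun y => hM _)
  have hf'G : Integrable fun y => fderiv ℝ f (x - s • y) v * Real.exp (-μ * ‖y‖ ^ 2) :=
    hG.bdd_mul (c := L * ‖v‖) (by fun_prop) (Eventually.of_forall hL')
  have hvG : Integrable fun y => inner ℝ y v * Real.exp (-μ * ‖y‖ ^ 2) := by
    refine ((integrable_norm_mul_gaussian (E := E) hμ).const_mul ‖v‖).mono' (by fun_prop)
      (Eventually.of_forall fun y => ?_)
    rw [norm_mul, Real.norm_of_nonneg (Real.exp_pos _).le]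
    have := norm_inner_le_norm (𝕜 := ℝ) y v
    have := Real.exp_pos (-μ * ‖y‖ ^ 2)
    calc ‖(inner ℝ y v : ℝ)‖ * Real.exp (-μ * ‖y‖ ^ 2)
        ≤ ‖y‖ * ‖v‖ * Real.exp (-μ * ‖y‖ ^ 2) := by gcongr
      _ = _ := by ring
  have hfvG : Integrable fun y => f (x - s • y) * (inner ℝ y v * Real.exp (-μ * ‖y‖ ^ 2)) :=
    hvG.bdd_mul (c := M) (by have := hf.continuous; fun_prop) (Eventually.of_forall fun y => hM _)
  have key := integral_bilinear_hasFDerivAt_right_eq_neg_left_of_integrable (μ := volume)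
    (B := ContinuousLinearMap.mul ℝ ℝ) (v := v)
    (f := fun y => f (x - s • y)) (f' := fun y => -s • fderiv ℝ f (x - s • y))
    (g := fun y => Real.exp (-μ * ‖y‖ ^ 2))
    (g' := fun y => (-2 * μ * Real.exp (-μ * ‖y‖ ^ 2)) • innerSL ℝ y)
    ((hf'G.const_mul (-s)).congr (Eventually.of_forall fun y => by simp [mul_assoc]))
    ((hfvG.const_mul (-2 * μ)).congr (Eventually.of_forall fun y => by simp; ring))
    hfG (fun y _ => hd y) (fun y _ => hasFDerivAt_gaussian μ y)
  simp only [ContinuousLinearMap.mul_apply', _root_.smul_apply, smul_eq_mul,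
    innerSL_apply_apply] at key
  rw [← integral_const_mul, ← integral_const_mul]
  rw [← integral_neg] at key
  rw [← neg_inj, ← integral_neg, ← integral_neg]
  exact (integral_congr_ae (Eventually.of_forall fun y => by ring)).trans
    (key.trans (integral_congr_ae (Eventually.of_forall fun y => by dsimp only; ring)))

lemma hasDerivAt_gaussian_interpolation {μ : ℝ} (hμ : 0 < μ) {f : E → ℝ} (hf : ContDiff ℝ 1 f)
    (hfc : HasCompactSupport f) (θ : ℝ) :
    Integrable (fun p : E × E => f p.1 * fderiv ℝ f (Real.cos θ • p.1 + Real.sin θ • p.2)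
      (-Real.sin θ • p.1 + Real.cos θ • p.2) *
      (Real.exp (-μ * ‖p.1‖ ^ 2) * Real.exp (-μ * ‖p.2‖ ^ 2))) ∧
    HasDerivAt (fun θ : ℝ => ∫ p : E × E, f p.1 * f (Real.cos θ • p.1 + Real.sin θ • p.2) *
      (Real.exp (-μ * ‖p.1‖ ^ 2) * Real.exp (-μ * ‖p.2‖ ^ 2)))
      (∫ p : E × E, f p.1 * fderiv ℝ f (Real.cos θ • p.1 + Real.sin θ • p.2)
      (-Real.sin θ • p.1 + Real.cos θ • p.2) *
      (Real.exp (-μ * ‖p.1‖ ^ 2) * Real.exp (-μ * ‖p.2‖ ^ 2))) θ := by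
  obtain ⟨M, hM⟩ := hfc.exists_bound_of_continuous hf.continuous
  have hf' : Continuous (fderiv ℝ f) := hf.continuous_fderiv one_ne_zero
  have hfcont := hf.continuous
  obtain ⟨L, hL⟩ := (hfc.fderiv ℝ).exists_bound_of_continuous hf'
  have hM0 : 0 ≤ M := (norm_nonneg _).trans (hM 0)
  have hL0 : 0 ≤ L := (norm_nonneg _).trans (hL 0)
  refine hasDerivAt_integral_of_dominated_loc_of_deriv_le (𝕜 := ℝ) (s := Set.univ)
    (F := fun θ p => f p.1 * f (Real.cos θ • p.1 + Real.sin θ • p.2) *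
      (Real.exp (-μ * ‖p.1‖ ^ 2) * Real.exp (-μ * ‖p.2‖ ^ 2)))
    (F' := fun θ p => f p.1 * fderiv ℝ f (Real.cos θ • p.1 + Real.sin θ • p.2)
      (-Real.sin θ • p.1 + Real.cos θ • p.2) *
      (Real.exp (-μ * ‖p.1‖ ^ 2) * Real.exp (-μ * ‖p.2‖ ^ 2)))
    (bound := fun p : E × E => M * L * ((‖p.1‖ + ‖p.2‖) *
      (Real.exp (-μ * ‖p.1‖ ^ 2) * Real.exp (-μ * ‖p.2‖ ^ 2)))) univ_mem
    (Eventually.of_forall fun θ => ?_) ?_ ?_ (Eventually.of_forall fun p θ _ => ?_)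
    ((integrable_norm_add_mul_gaussian_prod hμ).const_mul _)
    (Eventually.of_forall fun p θ _ => ?_)
  · exact Continuous.aestronglyMeasurable (by fun_prop)
  · refine (integrable_gaussian_prod (E := E) hμ).bdd_mul (c := M * M)
      (Continuous.aestronglyMeasurable (by fun_prop)) (Eventually.of_forall fun p => ?_)
    rw [norm_mul]
    exact mul_le_mul (hM _) (hM _) (norm_nonneg _) hM0
  · exact Continuous.aestronglyMeasurable (by fun_prop)
  · have h1 : ‖-Real.sin θ • p.1 + Real.cos θ • p.2‖ ≤ ‖p.1‖ + ‖p.2‖ := by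
      refine (norm_add_le _ _).trans (add_le_add ?_ ?_) <;> rw [norm_smul]
      · exact mul_le_of_le_one_left (norm_nonneg _) (by simpa using Real.abs_sin_le_one θ)
      · exact mul_le_of_le_one_left (norm_nonneg _) (by simpa using Real.abs_cos_le_one θ)
    rw [norm_mul, norm_mul, Real.norm_of_nonneg
      (mul_pos (Real.exp_pos (-μ * ‖p.1‖ ^ 2)) (Real.exp_pos (-μ * ‖p.2‖ ^ 2))).le,
      ← mul_assoc (M * L)]
    refine mul_le_mul_of_nonneg_right ?_ (by positivity)
    rw [mul_assoc]
    refine mul_le_mul (hM p.1) ?_ (norm_nonneg _) hM0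
    refine (ContinuousLinearMap.le_opNorm _ _).trans ?_
    exact mul_le_mul (hL _) h1 (norm_nonneg _) hL0
  · have h1 : HasDerivAt (fun θ : ℝ => Real.cos θ • p.1 + Real.sin θ • p.2)
        (-Real.sin θ • p.1 + Real.cos θ • p.2) θ :=
      ((Real.hasDerivAt_cos θ).smul_const p.1).add ((Real.hasDerivAt_sin θ).smul_const p.2)
    have h2 := ((hf.differentiable one_ne_zero
      (Real.cos θ • p.1 + Real.sin θ • p.2)).hasFDerivAt).comp_hasDerivAt θ h1
    exact (h2.const_mul (f p.1)).mul_const _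

lemma abs_deriv_gaussian_interpolation_le {μ : ℝ} (hμ : 0 < μ) {f : E → ℝ}
    (hf : ContDiff ℝ 1 f) (hfc : HasCompactSupport f) (θ : ℝ) :
    2 * μ * |∫ p : E × E, f p.1 * fderiv ℝ f (Real.cos θ • p.1 + Real.sin θ • p.2)
      (-Real.sin θ • p.1 + Real.cos θ • p.2) *
      (Real.exp (-μ * ‖p.1‖ ^ 2) * Real.exp (-μ * ‖p.2‖ ^ 2))| ≤
    |Real.sin θ| * ∫ p : E × E, ‖fderiv ℝ f p.1‖ ^ 2 *
      (Real.exp (-μ * ‖p.1‖ ^ 2) * Real.exp (-μ * ‖p.2‖ ^ 2)) := by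
  set c := Real.cos θ
  set s := Real.sin θ
  have hcs : c ^ 2 + s ^ 2 = 1 := Real.cos_sq_add_sin_sq θ
  have hf' : Continuous (fderiv ℝ f) := hf.continuous_fderiv one_ne_zero
  have hfcont := hf.continuous
  obtain ⟨L, hL⟩ := (hfc.fderiv ℝ).exists_bound_of_continuous hf'
  have hL0 : 0 ≤ L := (norm_nonneg _).trans (hL 0)
  have hGG := integrable_gaussian_prod (E := E) hμ
  let F : E × E → ℝ := fun p => f p.1 * fderiv ℝ f (c • p.1 + s • p.2) (-s • p.1 + c • p.2) *
      (Real.exp (-μ * ‖p.1‖ ^ 2) * Real.exp (-μ * ‖p.2‖ ^ 2))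
  have hFcont : Continuous F := by fun_prop
  have hFint : Integrable F := (hasDerivAt_gaussian_interpolation hμ hf hfc θ).1
  have hFrot : ∀ p : E × E, F (c • p.1 - s • p.2, s • p.1 + c • p.2)
      = f (c • p.1 - s • p.2) * fderiv ℝ f p.1 p.2 *
      (Real.exp (-μ * ‖p.1‖ ^ 2) * Real.exp (-μ * ‖p.2‖ ^ 2)) := by
    intro p
    have e1 : c • (c • p.1 - s • p.2) + s • (s • p.1 + c • p.2) = p.1 := by
      have : c • (c • p.1 - s • p.2) + s • (s • p.1 + c • p.2) = (c ^ 2 + s ^ 2) • p.1 := by module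
      rw [this, hcs, one_smul]
    have e2 : -s • (c • p.1 - s • p.2) + c • (s • p.1 + c • p.2) = p.2 := by
      have : -s • (c • p.1 - s • p.2) + c • (s • p.1 + c • p.2) = (c ^ 2 + s ^ 2) • p.2 := by module
      rw [this, hcs, one_smul]
    simp only [F, e1, e2, gaussian_mul_planeRotation hcs]
  have hbd : ∀ x y : E, |fderiv ℝ f x ((InnerProductSpace.toDual ℝ E).symm (fderiv ℝ f y))|
      ≤ (‖fderiv ℝ f x‖ ^ 2 + ‖fderiv ℝ f y‖ ^ 2) / 2 := by
    intro x y
    have h1 := (fderiv ℝ f x).le_opNorm ((InnerProductSpace.toDual ℝ E).symm (fderiv ℝ f y))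
    rw [LinearIsometryEquiv.norm_map, Real.norm_eq_abs] at h1
    nlinarith [sq_nonneg (‖fderiv ℝ f x‖ - ‖fderiv ℝ f y‖)]
  have hvcont : Continuous fun x : E => (InnerProductSpace.toDual ℝ E).symm (fderiv ℝ f x) :=
    (InnerProductSpace.toDual ℝ E).symm.continuous.comp hf'
  have hsq : ∀ x, ‖fderiv ℝ f x‖ ^ 2 ≤ L ^ 2 := fun x => by gcongr; exact hL x
  have hN1 : Integrable fun p : E × E => ‖fderiv ℝ f p.1‖ ^ 2 *
      (Real.exp (-μ * ‖p.1‖ ^ 2) * Real.exp (-μ * ‖p.2‖ ^ 2)) :=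
    hGG.bdd_mul (c := L ^ 2) (Continuous.aestronglyMeasurable (by fun_prop))
      (Eventually.of_forall fun p => by
        rw [Real.norm_of_nonneg (by positivity)]; exact hsq _)
  have hN2 : Integrable fun p : E × E => ‖fderiv ℝ f (c • p.1 - s • p.2)‖ ^ 2 *
      (Real.exp (-μ * ‖p.1‖ ^ 2) * Real.exp (-μ * ‖p.2‖ ^ 2)) :=
    hGG.bdd_mul (c := L ^ 2) (Continuous.aestronglyMeasurable (by fun_prop))
      (Eventually.of_forall fun p => by
        rw [Real.norm_of_nonneg (by positivity)]; exact hsq _)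
  have hN12 : ∫ p : E × E, ‖fderiv ℝ f (c • p.1 - s • p.2)‖ ^ 2 *
      (Real.exp (-μ * ‖p.1‖ ^ 2) * Real.exp (-μ * ‖p.2‖ ^ 2))
      = ∫ p : E × E, ‖fderiv ℝ f p.1‖ ^ 2 *
      (Real.exp (-μ * ‖p.1‖ ^ 2) * Real.exp (-μ * ‖p.2‖ ^ 2)) := by
    rw [← integral_comp_planeRotation hcs (F := fun p : E × E => ‖fderiv ℝ f p.1‖ ^ 2 *
      (Real.exp (-μ * ‖p.1‖ ^ 2) * Real.exp (-μ * ‖p.2‖ ^ 2))) (by fun_prop)]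
    simp only [gaussian_mul_planeRotation hcs]
  let H : E × E → ℝ := fun p =>
    fderiv ℝ f (c • p.1 - s • p.2) ((InnerProductSpace.toDual ℝ E).symm (fderiv ℝ f p.1)) *
      (Real.exp (-μ * ‖p.1‖ ^ 2) * Real.exp (-μ * ‖p.2‖ ^ 2))
  have hHle : ∀ p, ‖H p‖ ≤ (1 / 2) * (‖fderiv ℝ f (c • p.1 - s • p.2)‖ ^ 2 *
      (Real.exp (-μ * ‖p.1‖ ^ 2) * Real.exp (-μ * ‖p.2‖ ^ 2)) + ‖fderiv ℝ f p.1‖ ^ 2 *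
      (Real.exp (-μ * ‖p.1‖ ^ 2) * Real.exp (-μ * ‖p.2‖ ^ 2))) := by
    intro p
    have hpos := mul_pos (Real.exp_pos (-μ * ‖p.1‖ ^ 2)) (Real.exp_pos (-μ * ‖p.2‖ ^ 2))
    simp only [H]
    rw [norm_mul, Real.norm_of_nonneg hpos.le, Real.norm_eq_abs]
    have := mul_le_mul_of_nonneg_right (hbd (c • p.1 - s • p.2) p.1) hpos.le
    linarith
  have hHint : Integrable H :=
    ((hN2.add hN1).const_mul (1 / 2)).mono' (Continuous.aestronglyMeasurable (by fun_prop))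
      (Eventually.of_forall hHle)
  have hmain : 2 * μ * ∫ p, F p = -s * ∫ p, H p := by
    have hF1 : Integrable fun p : E × E => f (c • p.1 - s • p.2) * fderiv ℝ f p.1 p.2 *
        (Real.exp (-μ * ‖p.1‖ ^ 2) * Real.exp (-μ * ‖p.2‖ ^ 2)) := by
      obtain ⟨M, hM⟩ := hfc.exists_bound_of_continuous hf.continuous
      have hM0 : 0 ≤ M := (norm_nonneg _).trans (hM 0)
      refine ((integrable_norm_add_mul_gaussian_prod (E := E) hμ).const_mul (M * L)).mono'
        (Continuous.aestronglyMeasurable (by fun_prop)) (Eventually.of_forall fun p => ?_)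
      rw [norm_mul, norm_mul, Real.norm_of_nonneg
        (mul_pos (Real.exp_pos (-μ * ‖p.1‖ ^ 2)) (Real.exp_pos (-μ * ‖p.2‖ ^ 2))).le,
        ← mul_assoc (M * L)]
      refine mul_le_mul_of_nonneg_right ?_ (by positivity)
      rw [mul_assoc]
      refine mul_le_mul (hM (c • p.1 - s • p.2)) ?_ (norm_nonneg _) hM0
      refine (ContinuousLinearMap.le_opNorm _ _).trans ?_
      exact mul_le_mul (hL _) (le_add_of_nonneg_left (norm_nonneg _)) (norm_nonneg _) hL0
    rw [← integral_comp_planeRotation hcs hFcont]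
    simp only [hFrot]
    rw [Measure.volume_eq_prod] at hF1 hHint ⊢
    rw [integral_prod _ hF1, integral_prod _ hHint, ← integral_const_mul, ← integral_const_mul]
    refine integral_congr_ae (Eventually.of_forall fun x => ?_)
    have := integral_mul_inner_mul_gaussian hμ hf hfc (c • x)
      ((InnerProductSpace.toDual ℝ E).symm (fderiv ℝ f x)) s
    have e : ∀ y, inner ℝ y ((InnerProductSpace.toDual ℝ E).symm (fderiv ℝ f x))
        = fderiv ℝ f x y := fun y => by
      rw [real_inner_comm, InnerProductSpace.toDual_symm_apply]
    simp only [e] at this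
    simp only [H]
    have pull : ∀ q : E → ℝ, ∫ y, q y * (Real.exp (-μ * ‖x‖ ^ 2) * Real.exp (-μ * ‖y‖ ^ 2))
        = Real.exp (-μ * ‖x‖ ^ 2) * ∫ y, q y * Real.exp (-μ * ‖y‖ ^ 2) := fun q => by
      rw [← integral_const_mul]
      exact integral_congr_ae (Eventually.of_forall fun y => by dsimp only; ring)
    rw [pull, pull, mul_left_comm, this, mul_left_comm]
  have habs : |∫ p, H p| ≤ ∫ p : E × E, ‖fderiv ℝ f p.1‖ ^ 2 *
      (Real.exp (-μ * ‖p.1‖ ^ 2) * Real.exp (-μ * ‖p.2‖ ^ 2)) := by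
    refine (norm_integral_le_of_norm_le ((hN2.add hN1).const_mul (1 / 2))
      (Eventually.of_forall hHle)).trans (le_of_eq ?_)
    rw [integral_const_mul, integral_add' hN2 hN1, hN12]
    ring
  calc 2 * μ * |∫ p, F p| = |2 * μ * ∫ p, F p| := by
        rw [abs_mul, abs_of_pos (show 0 < 2 * μ by positivity)]
    _ = |s| * |∫ p, H p| := by rw [hmain, abs_mul, abs_neg]
    _ ≤ _ := by gcongr

/-- The Poincaré inequality for the Gaussian weight `exp (-μ ‖x‖²)`. -/
theorem gaussian_poincare {μ : ℝ} (hμ : 0 < μ) {f : E → ℝ} (hf : ContDiff ℝ 1 f)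
    (hfc : HasCompactSupport f) :
    2 * μ * ((∫ x, f x ^ 2 * Real.exp (-μ * ‖x‖ ^ 2)) * (∫ x : E, Real.exp (-μ * ‖x‖ ^ 2))
      - (∫ x, f x * Real.exp (-μ * ‖x‖ ^ 2)) ^ 2)
    ≤ (∫ x, ‖fderiv ℝ f x‖ ^ 2 * Real.exp (-μ * ‖x‖ ^ 2)) *
      ∫ x : E, Real.exp (-μ * ‖x‖ ^ 2) := by
  let h : ℝ → ℝ := fun θ => ∫ p : E × E, f p.1 * f (Real.cos θ • p.1 + Real.sin θ • p.2) *
      (Real.exp (-μ * ‖p.1‖ ^ 2) * Real.exp (-μ * ‖p.2‖ ^ 2))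
  have hK : ∫ p : E × E, ‖fderiv ℝ f p.1‖ ^ 2 *
      (Real.exp (-μ * ‖p.1‖ ^ 2) * Real.exp (-μ * ‖p.2‖ ^ 2))
      = (∫ x, ‖fderiv ℝ f x‖ ^ 2 * Real.exp (-μ * ‖x‖ ^ 2)) *
        ∫ x : E, Real.exp (-μ * ‖x‖ ^ 2) := by
    rw [← integral_prod_mul, Measure.volume_eq_prod]
    congr 1; funext p; ring
  have h0 : h 0 = (∫ x, f x ^ 2 * Real.exp (-μ * ‖x‖ ^ 2)) *
      ∫ x : E, Real.exp (-μ * ‖x‖ ^ 2) := by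
    rw [← integral_prod_mul, ← Measure.volume_eq_prod]
    simp only [h, Real.cos_zero, Real.sin_zero, one_smul, zero_smul, add_zero]
    congr 1; funext p; ring
  have h1 : h (Real.pi / 2) = (∫ x, f x * Real.exp (-μ * ‖x‖ ^ 2)) ^ 2 := by
    rw [sq, ← integral_prod_mul, ← Measure.volume_eq_prod]
    simp only [h, Real.cos_pi_div_two, Real.sin_pi_div_two, one_smul, zero_smul, zero_add]
    congr 1; funext p; ring
  rw [← hK, ← h0, ← h1]
  set K := ∫ p : E × E, ‖fderiv ℝ f p.1‖ ^ 2 *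
      (Real.exp (-μ * ‖p.1‖ ^ 2) * Real.exp (-μ * ‖p.2‖ ^ 2))
  have hd : ∀ θ, HasDerivAt (fun θ => 2 * μ * h θ - K * Real.cos θ) _ θ := fun θ =>
    ((hasDerivAt_gaussian_interpolation hμ hf hfc θ).2.const_mul (2 * μ)).sub
      ((Real.hasDerivAt_cos θ).const_mul K)
  have hmono : MonotoneOn (fun θ => 2 * μ * h θ - K * Real.cos θ) (Icc 0 (Real.pi / 2)) := by
    refine monotoneOn_of_hasDerivWithinAt_nonneg (convex_Icc _ _)
      (fun θ _ => (hd θ).continuousAt.continuousWithinAt)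
      (fun θ _ => (hd θ).hasDerivWithinAt) (fun θ hθ => ?_)
    rw [interior_Icc] at hθ
    have hb := abs_deriv_gaussian_interpolation_le hμ hf hfc θ
    rw [abs_of_nonneg (Real.sin_nonneg_of_nonneg_of_le_pi hθ.1.le
      (by linarith [hθ.2, Real.pi_pos]))] at hb
    have := mul_le_mul_of_nonneg_left (neg_abs_le (∫ p : E × E, f p.1 *
      fderiv ℝ f (Real.cos θ • p.1 + Real.sin θ • p.2)
      (-Real.sin θ • p.1 + Real.cos θ • p.2) *
      (Real.exp (-μ * ‖p.1‖ ^ 2) * Real.exp (-μ * ‖p.2‖ ^ 2)))) (show 0 ≤ 2 * μ by positivity)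
    linarith
  have hle := hmono (left_mem_Icc.mpr (by positivity)) (right_mem_Icc.mpr (by positivity))
    (show (0 : ℝ) ≤ Real.pi / 2 by positivity)
  simp only [Real.cos_zero, Real.cos_pi_div_two] at hle
  linarith

end GaussianPoincare

section Energy

variable {d : ℕ}

lemma gradient_apply_coord {u : EuclideanSpace ℝ (Fin d) → ℝ} (x : EuclideanSpace ℝ (Fin d))
    (i : Fin d) : (gradient u x) i = fderiv ℝ u x (EuclideanSpace.single i 1) := by
  have h : inner ℝ (gradient u x) (EuclideanSpace.single i 1)
      = fderiv ℝ u x (EuclideanSpace.single i 1) := InnerProductSpace.toDual_symm_apply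
  rw [← h, EuclideanSpace.inner_single_right, one_mul, RCLike.conj_to_real]

lemma inner_gradient_gradient (u v : EuclideanSpace ℝ (Fin d) → ℝ)
    (x : EuclideanSpace ℝ (Fin d)) :
    inner ℝ (gradient u x) (gradient v x) = ∑ i, fderiv ℝ u x (EuclideanSpace.single i 1) *
      fderiv ℝ v x (EuclideanSpace.single i 1) := by
  rw [PiLp.inner_apply]
  simp [gradient_apply_coord, mul_comm]

lemma norm_gradient (u : EuclideanSpace ℝ (Fin d) → ℝ) (x : EuclideanSpace ℝ (Fin d)) :
    ‖gradient u x‖ = ‖fderiv ℝ u x‖ :=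
  (InnerProductSpace.toDual ℝ (EuclideanSpace ℝ (Fin d))).symm.norm_map _

lemma integral_mul_partial {u v : EuclideanSpace ℝ (Fin d) → ℝ} (hu : ContDiff ℝ 1 u)
    (hv : ContDiff ℝ 1 v) (huc : HasCompactSupport u) (e : EuclideanSpace ℝ (Fin d)) :
    ∫ x, u x * fderiv ℝ v x e = -∫ x, fderiv ℝ u x e * v x := by
  have hu0 := hu.continuous
  have hv0 := hv.continuous
  have hu1 := hu.continuous_fderiv one_ne_zero
  have hv1 := hv.continuous_fderiv one_ne_zero
  refine integral_mul_fderiv_eq_neg_fderiv_mul_of_integrable ?_ ?_ ?_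
    (fun x _ => hu.differentiable one_ne_zero x) (fun x _ => hv.differentiable one_ne_zero x)
  · exact (hu1.clm_apply continuous_const |>.mul hv0).integrable_of_hasCompactSupport
      (huc.fderiv_apply ℝ e).mul_right
  · exact (hu0.mul (hv1.clm_apply continuous_const)).integrable_of_hasCompactSupport huc.mul_right
  · exact (hu0.mul hv0).integrable_of_hasCompactSupport huc.mul_right

/-- The Dirichlet form of `-Δ + μ²‖x‖²` on the whole space. -/
noncomputable def oscEnergy (μ : ℝ) (u v : EuclideanSpace ℝ (Fin d) → ℝ) : ℝ :=
  ∫ x, (inner ℝ (gradient u x) (gradient v x) + μ ^ 2 * ‖x‖ ^ 2 * (u x * v x))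

lemma continuous_gradient {u : EuclideanSpace ℝ (Fin d) → ℝ} (hu : ContDiff ℝ 1 u) :
    Continuous (gradient u) :=
  (InnerProductSpace.toDual ℝ (EuclideanSpace ℝ (Fin d))).symm.continuous.comp
    (hu.continuous_fderiv one_ne_zero)

lemma gradient_eq_zero_of_notMem_tsupport {u : EuclideanSpace ℝ (Fin d) → ℝ}
    {x : EuclideanSpace ℝ (Fin d)} (hx : x ∉ tsupport u) : gradient u x = 0 := by
  rw [← norm_eq_zero, norm_gradient, norm_eq_zero]
  exact image_eq_zero_of_notMem_tsupport fun h => hx (tsupport_fderiv_subset ℝ h)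

lemma integrable_oscEnergy (μ : ℝ) {u v : EuclideanSpace ℝ (Fin d) → ℝ} (hu : ContDiff ℝ 1 u)
    (hv : ContDiff ℝ 1 v) (huc : HasCompactSupport u) :
    Integrable fun x => inner ℝ (gradient u x) (gradient v x) +
      μ ^ 2 * ‖x‖ ^ 2 * (u x * v x) := by
  have := hu.continuous
  have := hv.continuous
  have := continuous_gradient hu
  have := continuous_gradient hv
  refine Continuous.integrable_of_hasCompactSupport (by fun_prop) ?_
  refine HasCompactSupport.intro huc.isCompact fun x hx => ?_
  simp [gradient_eq_zero_of_notMem_tsupport hx, image_eq_zero_of_notMem_tsupport hx]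

lemma integral_inner_self_gradient {u : EuclideanSpace ℝ (Fin d) → ℝ} (hu : ContDiff ℝ 1 u)
    (huc : HasCompactSupport u) :
    ∫ x, 2 * u x * fderiv ℝ u x x = -(d * ∫ x, u x ^ 2) := by
  have hsq : ContDiff ℝ 1 fun x => u x ^ 2 := hu.pow 2
  have hsqc : HasCompactSupport fun x => u x ^ 2 := huc.comp_left (g := fun t => t ^ 2) (by simp)
  have hd : ∀ x, fderiv ℝ (fun x => u x ^ 2) x = (2 * u x) • fderiv ℝ u x := fun x => by
    have := ((hu.differentiable one_ne_zero x).hasFDerivAt.pow 2).fderiv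
    simpa [nsmul_eq_mul] using this
  have hcoord : ∀ i : Fin d, ∫ x : EuclideanSpace ℝ (Fin d),
      fderiv ℝ (fun x => u x ^ 2) x (EuclideanSpace.single i 1) * x i = -∫ x, u x ^ 2 := by
    intro i
    have hc : ContDiff ℝ 1 fun x : EuclideanSpace ℝ (Fin d) => x i :=
      (EuclideanSpace.proj i : EuclideanSpace ℝ (Fin d) →L[ℝ] ℝ).contDiff
    have hfd : ∀ x : EuclideanSpace ℝ (Fin d),
        fderiv ℝ (fun x : EuclideanSpace ℝ (Fin d) => x i) x (EuclideanSpace.single i 1) = 1 := by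
      intro x
      have := (EuclideanSpace.proj i : EuclideanSpace ℝ (Fin d) →L[ℝ] ℝ).hasFDerivAt (x := x)
      rw [show (fun x : EuclideanSpace ℝ (Fin d) => x i) =
        ⇑(EuclideanSpace.proj i : EuclideanSpace ℝ (Fin d) →L[ℝ] ℝ) from rfl, this.fderiv]
      simp
    have := integral_mul_partial hsq hc hsqc (EuclideanSpace.single i 1)
    simp only [hfd, mul_one] at this
    linarith
  have hexp : ∀ x, 2 * u x * fderiv ℝ u x x
      = ∑ i, fderiv ℝ (fun x => u x ^ 2) x (EuclideanSpace.single i 1) * x i := by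
    intro x
    have hx : x = ∑ i, x i • EuclideanSpace.single i (1 : ℝ) := by
      ext j
      simp [Finset.sum_apply, Pi.single_apply]
    conv_lhs => rw [hx, map_sum, ← hx]
    simp only [hd, map_smul, _root_.smul_apply, smul_eq_mul, Finset.mul_sum]
    exact Finset.sum_congr rfl fun i _ => by ring
  simp only [hexp]
  rw [integral_finsetSum]
  · simp [hcoord]
  · intro i _
    have := hsq.continuous_fderiv one_ne_zero
    exact Continuous.integrable_of_hasCompactSupport (by fun_prop)
      (hsqc.fderiv_apply ℝ _).mul_right

/-- The ground state transform of the harmonic oscillator form. -/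
lemma integral_norm_fderiv_ground_state_quotient (μ : ℝ) {u : EuclideanSpace ℝ (Fin d) → ℝ}
    (hu : ContDiff ℝ 1 u) (huc : HasCompactSupport u) :
    ∫ x, ‖fderiv ℝ (fun x => u x * Real.exp (μ / 2 * ‖x‖ ^ 2)) x‖ ^ 2 *
      Real.exp (-μ * ‖x‖ ^ 2) = oscEnergy μ u u - d * μ * ∫ x, u x ^ 2 := by
  have hpt : ∀ x, ‖fderiv ℝ (fun x => u x * Real.exp (μ / 2 * ‖x‖ ^ 2)) x‖ ^ 2 *
      Real.exp (-μ * ‖x‖ ^ 2) = (inner ℝ (gradient u x) (gradient u x) +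
        μ ^ 2 * ‖x‖ ^ 2 * (u x * u x)) + μ * (2 * u x * fderiv ℝ u x x) := by
    intro x
    have h1 := (hasFDerivAt_gaussian (-(μ / 2)) x)
    have h2 := ((hu.differentiable one_ne_zero x).hasFDerivAt.mul h1)
    have h3 : fderiv ℝ (fun x => u x * Real.exp (μ / 2 * ‖x‖ ^ 2)) x
        = Real.exp (μ / 2 * ‖x‖ ^ 2) •
          InnerProductSpace.toDual ℝ (EuclideanSpace ℝ (Fin d))
            (gradient u x + (μ * u x) • x) := by
      simp only [neg_neg] at h2
      refine h2.fderiv.trans ?_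
      ext v
      simp
      ring
    rw [h3, norm_smul, LinearIsometryEquiv.norm_map, mul_pow, norm_add_sq_real, norm_smul,
      inner_smul_right, Real.norm_of_nonneg (Real.exp_pos _).le, ← Real.exp_nat_mul,
      real_inner_self_eq_norm_sq]
    have hg : inner ℝ (gradient u x) x = fderiv ℝ u x x :=
      InnerProductSpace.toDual_symm_apply
    rw [hg, mul_right_comm, ← Real.exp_add]
    have : ((2 : ℕ) : ℝ) * (μ / 2 * ‖x‖ ^ 2) + -μ * ‖x‖ ^ 2 = 0 := by push_cast; ring
    rw [this, Real.exp_zero, mul_pow, Real.norm_eq_abs, sq_abs]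
    ring
  have hint : Integrable fun x => μ * (2 * u x * fderiv ℝ u x x) := by
    have := hu.continuous
    have := hu.continuous_fderiv one_ne_zero
    refine Continuous.integrable_of_hasCompactSupport (by fun_prop) ?_
    exact HasCompactSupport.intro huc.isCompact fun x hx => by
      simp [image_eq_zero_of_notMem_tsupport hx]
  simp only [hpt]
  rw [integral_add (integrable_oscEnergy μ hu hu huc) hint, integral_const_mul,
    integral_inner_self_gradient hu huc, oscEnergy]
  ring

/-- The spectral gap of the harmonic oscillator: modulo its ground state, the form is at least
`(d + 2) μ`. -/
theorem oscillator_spectral_gap {μ : ℝ} (hμ : 0 < μ) {u : EuclideanSpace ℝ (Fin d) → ℝ}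
    (hu : ContDiff ℝ 1 u) (huc : HasCompactSupport u) :
    (d + 2) * μ * ∫ x, u x ^ 2 ≤ oscEnergy μ u u +
      2 * μ * (∫ x, u x * Real.exp (-(μ / 2) * ‖x‖ ^ 2)) ^ 2 /
        ∫ x : EuclideanSpace ℝ (Fin d), Real.exp (-μ * ‖x‖ ^ 2) := by
  have hf : ContDiff ℝ 1 fun x => u x * Real.exp (μ / 2 * ‖x‖ ^ 2) :=
    hu.mul (Real.contDiff_exp.comp (contDiff_const.mul (contDiff_norm_sq ℝ)))
  have hP := gaussian_poincare hμ hf huc.mul_right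
  rw [integral_norm_fderiv_ground_state_quotient μ hu huc] at hP
  have hexp : ∀ x : EuclideanSpace ℝ (Fin d), Real.exp (-μ * ‖x‖ ^ 2)
      = Real.exp (-(μ / 2) * ‖x‖ ^ 2) * Real.exp (-(μ / 2) * ‖x‖ ^ 2) := fun x => by
    rw [← Real.exp_add]; ring_nf
  have hinv : ∀ x : EuclideanSpace ℝ (Fin d),
      Real.exp (μ / 2 * ‖x‖ ^ 2) * Real.exp (-(μ / 2) * ‖x‖ ^ 2) = 1 := fun x => by
    rw [← Real.exp_add]; simp
  have e1 : ∀ x, (u x * Real.exp (μ / 2 * ‖x‖ ^ 2)) ^ 2 * Real.exp (-μ * ‖x‖ ^ 2) = u x ^ 2 := by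
    intro x
    rw [hexp]
    linear_combination u x ^ 2 * (Real.exp (μ / 2 * ‖x‖ ^ 2) *
      Real.exp (-(μ / 2) * ‖x‖ ^ 2) + 1) * hinv x
  have e2 : ∀ x, u x * Real.exp (μ / 2 * ‖x‖ ^ 2) * Real.exp (-μ * ‖x‖ ^ 2)
      = u x * Real.exp (-(μ / 2) * ‖x‖ ^ 2) := by
    intro x
    rw [hexp]
    linear_combination u x * Real.exp (-(μ / 2) * ‖x‖ ^ 2) * hinv x
  simp only [e1, e2] at hP
  have hZ : 0 < ∫ x : EuclideanSpace ℝ (Fin d), Real.exp (-μ * ‖x‖ ^ 2) :=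
    integral_exp_pos (integrable_gaussian hμ)
  set Z := ∫ x : EuclideanSpace ℝ (Fin d), Real.exp (-μ * ‖x‖ ^ 2)
  rw [← sub_le_iff_le_add', le_div_iff₀ hZ]
  linarith

end Energy

section TestFunctions

variable {d : ℕ} {R : ℝ}

lemma IsTestFun.contDiff_one {u : EuclideanSpace ℝ (Fin d) → ℝ} (hu : IsTestFun d R u) :
    ContDiff ℝ 1 u :=
  hu.1.of_le (by exact_mod_cast le_top)

lemma IsTestFun.linearComb {u v : EuclideanSpace ℝ (Fin d) → ℝ} (hu : IsTestFun d R u)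
    (hv : IsTestFun d R v) (a b : ℝ) : IsTestFun d R (a • u + b • v) := by
  refine ⟨(hu.1.const_smul a).add (hv.1.const_smul b),
    (hu.2.1.smul_left (f := fun _ => a)).add (hv.2.1.smul_left (f := fun _ => b)), ?_⟩
  refine (closure_minimal (fun x hx => ?_) ((isClosed_tsupport u).union
    (isClosed_tsupport v))).trans (union_subset hu.2.2 hv.2.2)
  by_contra hx'
  rw [mem_union, not_or] at hx'
  simp [image_eq_zero_of_notMem_tsupport hx'.1, image_eq_zero_of_notMem_tsupport hx'.2] at hx

lemma IsTestFun.rayleigh_eq {w : EuclideanSpace ℝ (Fin d) → ℝ} (hw : IsTestFun d R w) (μ : ℝ) :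
    rayleigh d R μ w = oscEnergy μ w w / ∫ x, w x ^ 2 := by
  have hz : ∀ x, x ∉ ball (0 : EuclideanSpace ℝ (Fin d)) R → x ∉ tsupport w :=
    fun x hx h => hx (hw.2.2 h)
  rw [rayleigh, oscEnergy, setIntegral_eq_integral_of_forall_compl_eq_zero fun x hx => by
      simp [gradient_eq_zero_of_notMem_tsupport (hz x hx),
        image_eq_zero_of_notMem_tsupport (hz x hx)],
    setIntegral_eq_integral_of_forall_compl_eq_zero fun x hx => by
      simp [image_eq_zero_of_notMem_tsupport (hz x hx)]]
  simp only [real_inner_self_eq_norm_sq, sq (w _)]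

lemma integrable_mul_of_hasCompactSupport {u v : EuclideanSpace ℝ (Fin d) → ℝ}
    (hu : Continuous u) (huc : HasCompactSupport u) (hv : Continuous v) :
    Integrable fun x => u x * v x :=
  (hu.mul hv).integrable_of_hasCompactSupport huc.mul_right

lemma integral_linearComb_three {p q r : EuclideanSpace ℝ (Fin d) → ℝ} (hp : Integrable p)
    (hq : Integrable q) (hr : Integrable r) (a b c : ℝ) :
    ∫ x, (a * p x + b * q x + c * r x) = a * (∫ x, p x) + b * (∫ x, q x) + c * ∫ x, r x := by
  have h : Integrable fun x => a * p x + b * q x := (hp.const_mul a).add (hq.const_mul b)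
  rw [integral_add h (hr.const_mul c), integral_add (hp.const_mul a) (hq.const_mul b),
    integral_const_mul, integral_const_mul, integral_const_mul]

lemma integral_sq_linearComb {u v : EuclideanSpace ℝ (Fin d) → ℝ} (hu : IsTestFun d R u)
    (hv : IsTestFun d R v) (a b : ℝ) :
    ∫ x, (a • u + b • v) x ^ 2 =
      a ^ 2 * (∫ x, u x ^ 2) + 2 * a * b * (∫ x, u x * v x) + b ^ 2 * ∫ x, v x ^ 2 := by
  have h1 := integrable_mul_of_hasCompactSupport hu.1.continuous hu.2.1 hu.1.continuous
  have h2 := integrable_mul_of_hasCompactSupport hu.1.continuous hu.2.1 hv.1.continuous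
  have h3 := integrable_mul_of_hasCompactSupport hv.1.continuous hv.2.1 hv.1.continuous
  simp only [sq (u _), sq (v _)]
  rw [← integral_linearComb_three h1 h2 h3]
  refine integral_congr_ae (Eventually.of_forall fun x => ?_)
  simp only [Pi.add_apply, Pi.smul_apply, smul_eq_mul]
  ring

lemma integral_mul_linearComb {u v g : EuclideanSpace ℝ (Fin d) → ℝ} (hu : IsTestFun d R u)
    (hv : IsTestFun d R v) (hg : Continuous g) (a b : ℝ) :
    ∫ x, (a • u + b • v) x * g x = a * (∫ x, u x * g x) + b * ∫ x, v x * g x := by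
  have h1 := integrable_mul_of_hasCompactSupport hu.1.continuous hu.2.1 hg
  have h2 := integrable_mul_of_hasCompactSupport hv.1.continuous hv.2.1 hg
  rw [← integral_const_mul, ← integral_const_mul,
    ← integral_add (h1.const_mul _) (h2.const_mul _)]
  refine integral_congr_ae (Eventually.of_forall fun x => ?_)
  simp only [Pi.add_apply, Pi.smul_apply, smul_eq_mul]
  ring

lemma oscEnergy_linearComb (μ : ℝ) {u v : EuclideanSpace ℝ (Fin d) → ℝ} (hu : IsTestFun d R u)
    (hv : IsTestFun d R v) (a b : ℝ) :
    oscEnergy μ (a • u + b • v) (a • u + b • v) =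
      a ^ 2 * oscEnergy μ u u + 2 * a * b * oscEnergy μ u v + b ^ 2 * oscEnergy μ v v := by
  have h1 := integrable_oscEnergy μ hu.contDiff_one hu.contDiff_one hu.2.1
  have h2 := integrable_oscEnergy μ hu.contDiff_one hv.contDiff_one hu.2.1
  have h3 := integrable_oscEnergy μ hv.contDiff_one hv.contDiff_one hv.2.1
  simp only [oscEnergy]
  rw [← integral_linearComb_three h1 h2 h3]
  refine integral_congr_ae (Eventually.of_forall fun x => ?_)
  have hg : gradient (a • u + b • v) x = a • gradient u x + b • gradient v x := by
    have hu1 := hu.contDiff_one.differentiable one_ne_zero x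
    have hv1 := hv.contDiff_one.differentiable one_ne_zero x
    simp only [gradient]
    rw [fderiv_add (hu1.const_smul a) (hv1.const_smul b), fderiv_const_smul hu1,
      fderiv_const_smul hv1, map_add]
    simp
  simp only [hg, Pi.add_apply, Pi.smul_apply, smul_eq_mul, inner_add_left, inner_add_right,
    inner_smul_left, inner_smul_right, RCLike.conj_to_real,
    real_inner_comm (gradient u x) (gradient v x)]
  ring

lemma IsTestFun.integral_sq_pos {w : EuclideanSpace ℝ (Fin d) → ℝ} (hw : IsTestFun d R w)
    (h0 : w ≠ 0) : 0 < ∫ x, w x ^ 2 := by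
  obtain ⟨x, hx⟩ := Function.ne_iff.mp h0
  exact (hw.1.continuous.pow 2).integral_pos_of_hasCompactSupport_nonneg_nonzero
    (hw.2.1.comp_left (g := fun t => t ^ 2) (by simp)) (fun x => sq_nonneg (w x))
    (x := x) (pow_ne_zero 2 hx)

lemma oscEnergy_self_nonneg (μ : ℝ) (u : EuclideanSpace ℝ (Fin d) → ℝ) : 0 ≤ oscEnergy μ u u :=
  integral_nonneg fun x => add_nonneg real_inner_self_nonneg
    (mul_nonneg (by positivity) (mul_self_nonneg _))

/-- Two real numbers always satisfy a nontrivial linear relation. -/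
lemma exists_ne_zero_linear_relation (p q : ℝ) :
    ∃ a b : ℝ, (a ≠ 0 ∨ b ≠ 0) ∧ a * p + b * q = 0 := by
  by_cases hp : p = 0
  · exact ⟨1, 0, Or.inl one_ne_zero, by simp [hp]⟩
  · exact ⟨q, -p, Or.inr (neg_ne_zero.mpr hp), by ring⟩

/-- The quotient of a binary quadratic form by a positive definite one is bounded above. -/
lemma exists_bound_quadratic_quotient {A B C : ℝ}
    (hpos : ∀ a b : ℝ, (a ≠ 0 ∨ b ≠ 0) → 0 < a ^ 2 * A + 2 * a * b * B + b ^ 2 * C)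
    (A' B' C' : ℝ) : ∃ M : ℝ, ∀ a b : ℝ, (a ≠ 0 ∨ b ≠ 0) →
      (a ^ 2 * A' + 2 * a * b * B' + b ^ 2 * C') /
        (a ^ 2 * A + 2 * a * b * B + b ^ 2 * C) ≤ M := by
  have hA : 0 < A := by simpa using hpos 1 0 (by simp)
  have hC : 0 < C := by simpa using hpos 0 1 (by simp)
  have hD : 0 < A * C - B ^ 2 := by
    have h := hpos (-B) A (Or.inr hA.ne')
    have h' : 0 < A * (A * C - B ^ 2) := by linarith
    exact (mul_pos_iff_of_pos_left hA).mp h'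
  refine ⟨(|A'| + |B'| + |C'|) * (A + C) / (A * C - B ^ 2), fun a b hab => ?_⟩
  rw [div_le_div_iff₀ (hpos a b hab) hD]
  have h1 : (A * C - B ^ 2) * (a ^ 2 + b ^ 2)
      ≤ (A + C) * (a ^ 2 * A + 2 * a * b * B + b ^ 2 * C) := by
    nlinarith [sq_nonneg (A * a + B * b), sq_nonneg (B * a + C * b)]
  have h2 : a ^ 2 * A' + 2 * a * b * B' + b ^ 2 * C'
      ≤ (|A'| + |B'| + |C'|) * (a ^ 2 + b ^ 2) := by
    have e1 := mul_le_mul_of_nonneg_left (le_abs_self A') (sq_nonneg a)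
    have e2 := mul_le_mul_of_nonneg_left (le_abs_self C') (sq_nonneg b)
    have e3 : 2 * a * b * B' ≤ (a ^ 2 + b ^ 2) * |B'| := by
      have := abs_nonneg B'
      rcases abs_cases B' with ⟨h, _⟩ | ⟨h, _⟩ <;> rw [h] at this ⊢ <;>
        nlinarith [mul_nonneg this (sq_nonneg (a - b)), mul_nonneg this (sq_nonneg (a + b))]
    nlinarith [mul_nonneg (abs_nonneg A') (sq_nonneg b), mul_nonneg (abs_nonneg C') (sq_nonneg a)]
  calc _ ≤ (|A'| + |B'| + |C'|) * (a ^ 2 + b ^ 2) * (A * C - B ^ 2) := by gcongr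
    _ = (|A'| + |B'| + |C'|) * ((A * C - B ^ 2) * (a ^ 2 + b ^ 2)) := by ring
    _ ≤ (|A'| + |B'| + |C'|) * ((A + C) * (a ^ 2 * A + 2 * a * b * B + b ^ 2 * C)) := by gcongr
    _ = _ := by ring

theorem le_sSup_rayleigh_linearComb {μ : ℝ} (hμ : 0 < μ)
    {w₁ w₂ : EuclideanSpace ℝ (Fin d) → ℝ} (h₁ : IsTestFun d R w₁) (h₂ : IsTestFun d R w₂)
    (hli : LinearIndependent ℝ ![w₁, w₂]) :
    ((d : ℝ) + 2) * μ ≤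
      sSup {ν : ℝ | ∃ a b : ℝ, a • w₁ + b • w₂ ≠ 0 ∧ ν = rayleigh d R μ (a • w₁ + b • w₂)} := by
  have hne : ∀ a b : ℝ, (a ≠ 0 ∨ b ≠ 0) → a • w₁ + b • w₂ ≠ 0 := by
    intro a b hab h
    obtain ⟨ha, hb⟩ := LinearIndependent.pair_iff.mp hli a b h
    simp [ha, hb] at hab
  have hne' : ∀ a b : ℝ, a • w₁ + b • w₂ ≠ 0 → (a ≠ 0 ∨ b ≠ 0) := by
    intro a b h
    by_contra hab
    push Not at hab
    simp [hab] at h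
  have hbdd : BddAbove {ν : ℝ | ∃ a b : ℝ, a • w₁ + b • w₂ ≠ 0 ∧
      ν = rayleigh d R μ (a • w₁ + b • w₂)} := by
    obtain ⟨M, hM⟩ := exists_bound_quadratic_quotient
      (A := ∫ x, w₁ x ^ 2) (B := ∫ x, w₁ x * w₂ x) (C := ∫ x, w₂ x ^ 2)
      (fun a b hab => by
        rw [← integral_sq_linearComb h₁ h₂]
        exact (h₁.linearComb h₂ a b).integral_sq_pos (hne a b hab))
      (oscEnergy μ w₁ w₁) (oscEnergy μ w₁ w₂) (oscEnergy μ w₂ w₂)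
    refine ⟨M, ?_⟩
    rintro _ ⟨a, b, hab, rfl⟩
    rw [(h₁.linearComb h₂ a b).rayleigh_eq, oscEnergy_linearComb μ h₁ h₂,
      integral_sq_linearComb h₁ h₂]
    exact hM a b (hne' a b hab)
  obtain ⟨a, b, hab, horth⟩ := exists_ne_zero_linear_relation
    (∫ x, w₁ x * Real.exp (-(μ / 2) * ‖x‖ ^ 2)) (∫ x, w₂ x * Real.exp (-(μ / 2) * ‖x‖ ^ 2))
  have hw := h₁.linearComb h₂ a b
  refine le_trans ?_ (le_csSup hbdd ⟨a, b, hne a b hab, rfl⟩)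
  rw [hw.rayleigh_eq, le_div_iff₀ (hw.integral_sq_pos (hne a b hab))]
  have h := oscillator_spectral_gap hμ hw.contDiff_one hw.2.1
  rw [integral_mul_linearComb h₁ h₂ (by fun_prop), horth] at h
  simpa using h

end TestFunctions

section Truncation

/-- Smooth truncations `χ` of the identity that vanish near `0`, at every scale `ε`. -/
lemma exists_smooth_truncation : ∃ C : ℝ, 0 ≤ C ∧ ∀ ε : ℝ, 0 < ε → ∃ χ : ℝ → ℝ,
    ContDiff ℝ (⊤ : ℕ∞) χ ∧ (∀ t, |t| ≤ ε → χ t = 0) ∧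
      (∀ t, 0 ≤ deriv χ t ∧ deriv χ t ≤ 1) ∧ ∀ t, |χ t - t| ≤ C * ε := by
  let b : ContDiffBump (0 : ℝ) := ⟨1, 2, one_pos, one_lt_two⟩
  have hbc : Continuous b := b.contDiff (n := 0) |>.continuous
  have hbi : Integrable b := hbc.integrable_of_hasCompactSupport b.hasCompactSupport
  let χ : ℝ → ℝ := fun t => ∫ s in (0 : ℝ)..t, (1 - b s)
  have hder : ∀ t, HasDerivAt χ (1 - b t) t := fun t =>
    intervalIntegral.integral_hasDerivAt_right
      ((continuous_const.sub hbc).intervalIntegrable _ _)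
      ((continuous_const.sub hbc).stronglyMeasurableAtFilter _ _)
      (continuous_const.sub hbc).continuousAt
  have hderiv : deriv χ = fun t => 1 - b t := funext fun t => (hder t).deriv
  have hsmooth : ContDiff ℝ (⊤ : ℕ∞) χ := by
    rw [contDiff_infty_iff_deriv]
    refine ⟨fun t => (hder t).differentiableAt, ?_⟩
    rw [hderiv]
    exact contDiff_const.sub b.contDiff
  have hzero : ∀ t, |t| ≤ 1 → χ t = 0 := by
    intro t ht
    refine (intervalIntegral.integral_congr (g := fun _ => 0) fun s hs => ?_).trans (by simp)
    have hs' : |s| ≤ 1 := by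
      rw [abs_le] at ht ⊢
      rcases mem_uIcc.mp hs with h | h <;> constructor <;> linarith
    have : b s = 1 := b.one_of_mem_closedBall (by simpa [b, Real.norm_eq_abs] using hs')
    simp [this]
  have hbound : ∀ t, |χ t - t| ≤ ∫ s, b s := by
    intro t
    have h1 : χ t - t = -∫ s in (0 : ℝ)..t, b s := by
      simp only [χ]
      rw [intervalIntegral.integral_sub (by simp) (hbc.intervalIntegrable _ _)]
      simp
    rw [h1, abs_neg, ← Real.norm_eq_abs]
    refine (intervalIntegral.norm_integral_le_integral_norm_uIoc).trans ?_
    simp only [Real.norm_of_nonneg b.nonneg]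
    exact setIntegral_le_integral hbi (Eventually.of_forall fun _ => b.nonneg)
  refine ⟨∫ s, b s, integral_nonneg fun _ => b.nonneg, fun ε hε => ⟨fun t => ε * χ (t / ε),
    contDiff_const.mul (hsmooth.comp (contDiff_id.div_const ε)), fun t ht => ?_, fun t => ?_,
    fun t => ?_⟩⟩
  · simp [hzero (t / ε) (by rwa [abs_div, abs_of_pos hε, div_le_one hε])]
  · have : HasDerivAt (fun t => ε * χ (t / ε)) (1 - b (t / ε)) t := by
      have := ((hder (t / ε)).comp t ((hasDerivAt_id t).div_const ε)).const_mul ε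
      simpa [mul_div_cancel₀, hε.ne', mul_comm ε] using this
    rw [this.deriv]
    exact ⟨sub_nonneg.mpr b.le_one, by linarith [b.nonneg (x := t / ε)]⟩
  · have : ε * χ (t / ε) - t = (χ (t / ε) - t / ε) * ε := by field_simp
    rw [this, abs_mul, abs_of_pos hε]
    exact mul_le_mul_of_nonneg_right (hbound _) hε.le

variable {d : ℕ} {R : ℝ}

/-- A smooth function on a ball agrees near a given compact subset with a test function. -/
lemma exists_isTestFun_eventuallyEq {φ : EuclideanSpace ℝ (Fin d) → ℝ} (hR : 0 < R)
    (hφ : ContDiffOn ℝ (⊤ : ℕ∞) φ (ball (0 : EuclideanSpace ℝ (Fin d)) R))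
    {K : Set (EuclideanSpace ℝ (Fin d))} (hK : IsCompact K) (hKR : K ⊆ ball 0 R) :
    ∃ Φ : EuclideanSpace ℝ (Fin d) → ℝ, IsTestFun d R Φ ∧
      (∀ x ∈ K, Φ =ᶠ[nhds x] φ) ∧ ∀ x, |Φ x| ≤ |(ball 0 R).indicator φ x| := by
  obtain ⟨r, ⟨hr, hrR⟩, hKr⟩ := exists_pos_lt_subset_ball hR hK.isClosed hKR
  let ρ : ContDiffBump (0 : EuclideanSpace ℝ (Fin d)) := ⟨r, (r + R) / 2, hr, by linarith⟩
  have hρ : tsupport ρ ⊆ ball 0 R := by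
    rw [ρ.tsupport_eq]
    exact closedBall_subset_ball (by simp only [ρ]; linarith)
  have hsub : tsupport (fun x => ρ x * φ x) ⊆ tsupport ρ := tsupport_mul_subset_left
  refine ⟨fun x => ρ x * φ x, ⟨?_, ρ.hasCompactSupport.mul_right, hsub.trans hρ⟩, ?_, ?_⟩
  · refine contDiff_iff_contDiffAt.mpr fun x => ?_
    by_cases hx : x ∈ tsupport ρ
    · exact ρ.contDiffAt.mul (hφ.contDiffAt (isOpen_ball.mem_nhds (hρ hx)))
    · refine (contDiffAt_const (c := (0 : ℝ))).congr_of_eventuallyEq ?_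
      filter_upwards [(isClosed_tsupport ρ).isOpen_compl.mem_nhds hx] with y hy
      rw [image_eq_zero_of_notMem_tsupport hy, zero_mul]
  · intro x hx
    filter_upwards [isOpen_ball.mem_nhds (hKr hx)] with y hy
    rw [ρ.one_of_mem_closedBall (ball_subset_closedBall hy), one_mul]
  · intro x
    by_cases hx : x ∈ ball (0 : EuclideanSpace ℝ (Fin d)) R
    · rw [indicator_of_mem hx, abs_mul, abs_of_nonneg ρ.nonneg]
      exact mul_le_of_le_one_left (abs_nonneg _) ρ.le_one
    · have : ρ x = 0 := image_eq_zero_of_notMem_tsupport fun h => hx (hρ h)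
      simp [this]

lemma lapl_congr {u v : EuclideanSpace ℝ (Fin d) → ℝ} {x : EuclideanSpace ℝ (Fin d)}
    (h : u =ᶠ[nhds x] v) : lapl u x = lapl v x := by
  refine Finset.sum_congr rfl fun i _ => ?_
  have : (fun z => fderiv ℝ u z (EuclideanSpace.single i 1)) =ᶠ[nhds x]
      fun z => fderiv ℝ v z (EuclideanSpace.single i 1) :=
    (h.fderiv (𝕜 := ℝ)).mono fun z hz => by simp only [hz]
  rw [this.fderiv_eq]

lemma continuous_lapl {v : EuclideanSpace ℝ (Fin d) → ℝ} (hv : ContDiff ℝ (⊤ : ℕ∞) v) :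
    Continuous (lapl v) := by
  refine continuous_finsetSum _ fun i _ => ?_
  have : ContDiff ℝ 1 fun z => fderiv ℝ v z (EuclideanSpace.single i 1) :=
    (hv.fderiv_right (m := 1) (by norm_cast)).clm_apply contDiff_const
  exact (this.continuous_fderiv one_ne_zero).clm_apply continuous_const

/-- Green's formula for the Dirichlet form. -/
lemma oscEnergy_eq_integral_mul (μ : ℝ) {u v : EuclideanSpace ℝ (Fin d) → ℝ}
    (hu : ContDiff ℝ 1 u) (huc : HasCompactSupport u) (hv : ContDiff ℝ (⊤ : ℕ∞) v) :
    oscEnergy μ u v = ∫ x, u x * (-lapl v x + μ ^ 2 * ‖x‖ ^ 2 * v x) := by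
  have hv' : ∀ i : Fin d, ContDiff ℝ 1 fun z => fderiv ℝ v z (EuclideanSpace.single i 1) :=
    fun i => (hv.fderiv_right (m := 1) (by norm_cast)).clm_apply contDiff_const
  have hu0 := hu.continuous
  have hv0 := hv.continuous
  have hl := continuous_lapl hv
  have hgrad : ∫ x, inner ℝ (gradient u x) (gradient v x) = ∫ x, u x * -lapl v x := by
    have e : ∀ x, u x * -lapl v x = ∑ i, -(u x * fderiv ℝ (fun z => fderiv ℝ v z
        (EuclideanSpace.single i 1)) x (EuclideanSpace.single i 1)) := fun x => by
      rw [lapl, mul_neg, Finset.mul_sum, Finset.sum_neg_distrib]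
    simp only [inner_gradient_gradient, e]
    rw [integral_finsetSum, integral_finsetSum]
    · refine Finset.sum_congr rfl fun i _ => ?_
      rw [integral_neg, integral_mul_partial hu (hv' i) huc, neg_neg]
    · intro i _
      exact (integrable_mul_of_hasCompactSupport hu0 huc
        (((hv' i).continuous_fderiv one_ne_zero).clm_apply continuous_const)).neg
    · intro i _
      exact integrable_mul_of_hasCompactSupport
        ((hu.continuous_fderiv one_ne_zero).clm_apply continuous_const)
        (huc.fderiv_apply ℝ _) (hv' i).continuous
  have hgi : Integrable fun x => inner ℝ (gradient u x) (gradient v x) := by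
    have := continuous_gradient hu
    have := continuous_gradient (hv.of_le (m := 1) (by exact_mod_cast le_top))
    exact Continuous.integrable_of_hasCompactSupport (by fun_prop)
      (HasCompactSupport.intro huc.isCompact fun x hx => by
        simp [gradient_eq_zero_of_notMem_tsupport hx])
  have hpi : Integrable fun x => μ ^ 2 * ‖x‖ ^ 2 * (u x * v x) :=
    Continuous.integrable_of_hasCompactSupport (by fun_prop)
      (HasCompactSupport.intro huc.isCompact fun x hx => by
        simp [image_eq_zero_of_notMem_tsupport hx])
  rw [oscEnergy, integral_add hgi hpi, hgrad, ← integral_add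
    (f := fun x => u x * -lapl v x) (integrable_mul_of_hasCompactSupport hu0 huc hl.neg) hpi]
  refine integral_congr_ae (Eventually.of_forall fun x => ?_)
  ring

lemma oscEnergy_comm (μ : ℝ) (u v : EuclideanSpace ℝ (Fin d) → ℝ) :
    oscEnergy μ u v = oscEnergy μ v u := by
  simp only [oscEnergy, real_inner_comm (gradient u _), mul_comm (u _)]

/-- Truncating by a `1`-Lipschitz monotone function lowers the form. -/
lemma oscEnergy_comp_self_le (μ : ℝ) {χ : ℝ → ℝ} (hχ : ContDiff ℝ (⊤ : ℕ∞) χ)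
    (hχ' : ∀ t, 0 ≤ deriv χ t ∧ deriv χ t ≤ 1) (hχ0 : χ 0 = 0)
    {Φ : EuclideanSpace ℝ (Fin d) → ℝ} (hΦ : ContDiff ℝ (⊤ : ℕ∞) Φ) (hΦc : HasCompactSupport Φ) :
    oscEnergy μ (χ ∘ Φ) (χ ∘ Φ) ≤
      ∫ x, χ (Φ x) * (-lapl Φ x + μ ^ 2 * ‖x‖ ^ 2 * χ (Φ x)) := by
  have h1 : (1 : WithTop ℕ∞) ≤ (⊤ : ℕ∞) := by exact_mod_cast le_top
  have hp : ContDiff ℝ 1 (χ ∘ Φ) := (hχ.comp hΦ).of_le h1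
  have hpc : HasCompactSupport (χ ∘ Φ) := hΦc.comp_left hχ0
  have hΦ0 := hΦ.continuous
  have hp0 : Continuous fun x => χ (Φ x) := hχ.continuous.comp hΦ0
  have hsplit : ∫ x, χ (Φ x) * (-lapl Φ x + μ ^ 2 * ‖x‖ ^ 2 * χ (Φ x)) =
      oscEnergy μ (χ ∘ Φ) Φ + ∫ x, χ (Φ x) * (μ ^ 2 * ‖x‖ ^ 2 * (χ (Φ x) - Φ x)) := by
    have := continuous_lapl hΦ
    rw [oscEnergy_eq_integral_mul μ hp hpc hΦ]
    refine Eq.trans ?_ (integral_add (integrable_mul_of_hasCompactSupport hp0 hpc (by fun_prop))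
      (integrable_mul_of_hasCompactSupport hp0 hpc (by fun_prop)))
    refine integral_congr_ae (Eventually.of_forall fun x => ?_)
    simp only [Function.comp]
    ring
  have hI := integrable_oscEnergy μ hp (hΦ.of_le h1) hpc
  have hJ : Integrable fun x => χ (Φ x) * (μ ^ 2 * ‖x‖ ^ 2 * (χ (Φ x) - Φ x)) :=
    integrable_mul_of_hasCompactSupport hp0 hpc (by fun_prop)
  rw [hsplit]
  refine le_trans ?_ (integral_add hI hJ).le
  refine integral_mono (integrable_oscEnergy μ hp hp hpc) (hI.add hJ) fun x => ?_
  have hg : gradient (χ ∘ Φ) x = deriv χ (Φ x) • gradient Φ x := by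
    have := ((hχ.differentiable (by simp) (Φ x)).hasDerivAt.comp_hasFDerivAt x
      (hΦ.differentiable (by simp) x).hasFDerivAt).fderiv
    simp only [gradient, this]
    simp
  have hsq : deriv χ (Φ x) * (deriv χ (Φ x) * ‖gradient Φ x‖ ^ 2)
      ≤ deriv χ (Φ x) * ‖gradient Φ x‖ ^ 2 :=
    mul_le_of_le_one_left (mul_nonneg (hχ' _).1 (sq_nonneg _)) (hχ' _).2
  simp only [hg, inner_smul_left, inner_smul_right, RCLike.conj_to_real,
    real_inner_self_eq_norm_sq, Function.comp]
  nlinarith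

end Truncation

section Eigenfunction

variable {d : ℕ} {R μ ν : ℝ}

/-- `ψ` is a bounded pointwise limit of test functions whose Dirichlet form is asymptotically
controlled by `ν ∫ ψ²`, and it solves `-Δψ + μ²‖x‖²ψ = νψ` weakly on the ball. -/
structure IsFormLimit (R μ ν : ℝ) (ψ : EuclideanSpace ℝ (Fin d) → ℝ)
    (p : ℕ → EuclideanSpace ℝ (Fin d) → ℝ) : Prop where
  isTestFun : ∀ n, IsTestFun d R (p n)
  bounded : ∃ M, ∀ n x, |p n x| ≤ M
  tendsto : ∀ x, Tendsto (fun n => p n x) atTop (nhds (ψ x))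
  oscEnergy_le : ∀ n, oscEnergy μ (p n) (p n) ≤
    ∫ x, p n x * ((ν - μ ^ 2 * ‖x‖ ^ 2) * ψ x + μ ^ 2 * ‖x‖ ^ 2 * p n x)
  weak : ∀ w, IsTestFun d R w →
    ∫ x, ψ x * (-lapl w x + μ ^ 2 * ‖x‖ ^ 2 * w x) = ν * ∫ x, w x * ψ x
  integral_sq_pos : 0 < ∫ x, ψ x ^ 2

/-- Dominated convergence for uniformly bounded functions living on a fixed ball. -/
lemma tendsto_integral_of_bounded_on_ball {F : ℕ → EuclideanSpace ℝ (Fin d) → ℝ}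
    {f : EuclideanSpace ℝ (Fin d) → ℝ} (hm : ∀ n, AEStronglyMeasurable (F n) volume) {M : ℝ}
    (hM : ∀ n, ∀ x ∈ ball (0 : EuclideanSpace ℝ (Fin d)) R, |F n x| ≤ M)
    (h0 : ∀ n, ∀ x ∉ ball (0 : EuclideanSpace ℝ (Fin d)) R, F n x = 0)
    (hlim : ∀ x, Tendsto (fun n => F n x) atTop (nhds (f x))) :
    Tendsto (fun n => ∫ x, F n x) atTop (nhds (∫ x, f x)) := by
  refine tendsto_integral_of_dominated_convergence
    ((ball (0 : EuclideanSpace ℝ (Fin d)) R).indicator fun _ => M) hm ?_ (fun n => ?_)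
    (Eventually.of_forall hlim)
  · exact (integrable_indicator_iff measurableSet_ball).mpr
      (integrableOn_const measure_ball_lt_top.ne)
  · refine Eventually.of_forall fun x => ?_
    by_cases hx : x ∈ ball (0 : EuclideanSpace ℝ (Fin d)) R
    · simpa [indicator_of_mem hx] using hM n x hx
    · simp [indicator_of_notMem hx, h0 n x hx]

lemma IsTestFun.eq_zero {w : EuclideanSpace ℝ (Fin d) → ℝ} (hw : IsTestFun d R w)
    {x : EuclideanSpace ℝ (Fin d)} (hx : x ∉ ball (0 : EuclideanSpace ℝ (Fin d)) R) : w x = 0 :=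
  image_eq_zero_of_notMem_tsupport fun h => hx (hw.2.2 h)

lemma nuBottom_mul_le {w : EuclideanSpace ℝ (Fin d) → ℝ} (hw : IsTestFun d R w) :
    nuBottom d R μ * ∫ x, w x ^ 2 ≤ oscEnergy μ w w := by
  by_cases h0 : w = 0
  · subst h0
    simpa using oscEnergy_self_nonneg μ (0 : EuclideanSpace ℝ (Fin d) → ℝ)
  rw [← le_div_iff₀ (hw.integral_sq_pos h0), ← hw.rayleigh_eq]
  refine csInf_le ⟨0, ?_⟩ ⟨w, hw, h0, rfl⟩
  rintro _ ⟨v, hv, hv0, rfl⟩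
  rw [hv.rayleigh_eq]
  exact div_nonneg (oscEnergy_self_nonneg μ v) (hv.integral_sq_pos hv0).le

namespace IsFormLimit

variable {ψ : EuclideanSpace ℝ (Fin d) → ℝ} {p : ℕ → EuclideanSpace ℝ (Fin d) → ℝ}

lemma aestronglyMeasurable (h : IsFormLimit R μ ν ψ p) : AEStronglyMeasurable ψ volume :=
  aestronglyMeasurable_of_tendsto_ae atTop
    (fun n => (h.isTestFun n).1.continuous.aestronglyMeasurable) (Eventually.of_forall h.tendsto)

lemma exists_bound (h : IsFormLimit R μ ν ψ p) :
    ∃ M, 0 ≤ M ∧ (∀ n x, |p n x| ≤ M) ∧ ∀ x, |ψ x| ≤ M := by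
  obtain ⟨M, hM⟩ := h.bounded
  exact ⟨M, (abs_nonneg _).trans (hM 0 0), hM,
    fun x => le_of_tendsto (h.tendsto x).abs (Eventually.of_forall fun n => hM n x)⟩

lemma tendsto_integral_mul (h : IsFormLimit R μ ν ψ p) {q : EuclideanSpace ℝ (Fin d) → ℝ}
    (hq : Continuous q) :
    Tendsto (fun n => ∫ x, p n x * q x) atTop (nhds (∫ x, ψ x * q x)) := by
  obtain ⟨M, hM0, hM, -⟩ := h.exists_bound
  obtain ⟨N, hN⟩ := (isCompact_closedBall (0 : EuclideanSpace ℝ (Fin d))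
    R).exists_bound_of_continuousOn hq.continuousOn
  refine tendsto_integral_of_bounded_on_ball (R := R) (M := M * N)
    (fun n => ((h.isTestFun n).1.continuous.mul hq).aestronglyMeasurable) (fun n x hx => ?_)
    (fun n x hx => by rw [(h.isTestFun n).eq_zero hx, zero_mul])
    (fun x => (h.tendsto x).mul_const _)
  rw [abs_mul]
  exact mul_le_mul (hM n x) (hN x (ball_subset_closedBall hx)) (abs_nonneg _) hM0

lemma tendsto_integral_sq (h : IsFormLimit R μ ν ψ p) :
    Tendsto (fun n => ∫ x, p n x ^ 2) atTop (nhds (∫ x, ψ x ^ 2)) := by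
  obtain ⟨M, hM0, hM, -⟩ := h.exists_bound
  refine tendsto_integral_of_bounded_on_ball (R := R) (M := M ^ 2)
    (fun n => ((h.isTestFun n).1.continuous.pow 2).aestronglyMeasurable) (fun n x _ => ?_)
    (fun n x hx => by simp [(h.isTestFun n).eq_zero hx]) (fun x => (h.tendsto x).pow 2)
  rw [abs_pow]
  exact pow_le_pow_left₀ (abs_nonneg _) (hM n x) 2

lemma tendsto_energy_bound (h : IsFormLimit R μ ν ψ p) :
    Tendsto (fun n => ∫ x, p n x * ((ν - μ ^ 2 * ‖x‖ ^ 2) * ψ x + μ ^ 2 * ‖x‖ ^ 2 * p n x))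
      atTop (nhds (ν * ∫ x, ψ x ^ 2)) := by
  obtain ⟨M, hM0, hM, hψ⟩ := h.exists_bound
  rw [← integral_const_mul]
  have hm := h.aestronglyMeasurable
  refine tendsto_integral_of_bounded_on_ball (R := R)
    (M := M * ((|ν| + μ ^ 2 * R ^ 2) * M + μ ^ 2 * R ^ 2 * M)) (fun n => ?_) (fun n x hx => ?_)
    (fun n x hx => by simp [(h.isTestFun n).eq_zero hx]) (fun x => ?_)
  · have hp := (h.isTestFun n).1.continuous
    have hc : Continuous fun x : EuclideanSpace ℝ (Fin d) => ν - μ ^ 2 * ‖x‖ ^ 2 := by fun_prop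
    have hc' : Continuous fun x : EuclideanSpace ℝ (Fin d) => μ ^ 2 * ‖x‖ ^ 2 * p n x := by
      fun_prop
    exact hp.aestronglyMeasurable.mul
      ((hc.aestronglyMeasurable.mul hm).add hc'.aestronglyMeasurable)
  · have hxR : ‖x‖ ^ 2 ≤ R ^ 2 :=
      pow_le_pow_left₀ (norm_nonneg x) (mem_ball_zero_iff.mp hx).le 2
    have hμx : μ ^ 2 * ‖x‖ ^ 2 ≤ μ ^ 2 * R ^ 2 := mul_le_mul_of_nonneg_left hxR (sq_nonneg μ)
    have h1 : |ν - μ ^ 2 * ‖x‖ ^ 2| ≤ |ν| + μ ^ 2 * R ^ 2 :=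
      (abs_sub _ _).trans (by rw [abs_of_nonneg (a := μ ^ 2 * ‖x‖ ^ 2) (by positivity)]; linarith)
    rw [abs_mul]
    refine mul_le_mul (hM n x) ((abs_add_le _ _).trans (add_le_add ?_ ?_)) (abs_nonneg _) hM0
    · rw [abs_mul]
      exact mul_le_mul h1 (hψ x) (abs_nonneg _) (by positivity)
    · rw [abs_mul, abs_of_nonneg (a := μ ^ 2 * ‖x‖ ^ 2) (by positivity)]
      exact mul_le_mul hμx (hM n x) (abs_nonneg _) (by positivity)
  · have := (h.tendsto x).mul (((tendsto_const_nhds (x := (ν - μ ^ 2 * ‖x‖ ^ 2) * ψ x)).add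
      ((h.tendsto x).const_mul (μ ^ 2 * ‖x‖ ^ 2))))
    convert this using 2
    ring

/-- A lower bound of the Dirichlet form on test functions is at most `ν`. -/
lemma le_of_forall_mul_le_oscEnergy (h : IsFormLimit R μ ν ψ p) {c : ℝ}
    (hc : ∀ w, IsTestFun d R w → c * ∫ x, w x ^ 2 ≤ oscEnergy μ w w) : c ≤ ν := by
  have := le_of_tendsto_of_tendsto' (h.tendsto_integral_sq.const_mul c) h.tendsto_energy_bound
    fun n => (hc _ (h.isTestFun n)).trans (h.oscEnergy_le n)
  exact le_of_mul_le_mul_right this h.integral_sq_pos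

lemma exists_ne_zero (h : IsFormLimit R μ ν ψ p) : ∃ n, p n ≠ 0 := by
  by_contra! h0
  have := h.tendsto_integral_sq
  simp only [h0, Pi.zero_apply, ne_eq, OfNat.ofNat_ne_zero, not_false_eq_true, zero_pow,
    integral_zero] at this
  exact h.integral_sq_pos.ne (tendsto_nhds_unique tendsto_const_nhds this)

/-- Away from the bottom, some test function has Rayleigh quotient below `ν`. -/
lemma exists_oscEnergy_lt (h : IsFormLimit R μ ν ψ p) (hne : ν ≠ nuBottom d R μ) :
    ∃ w, IsTestFun d R w ∧ oscEnergy μ w w < ν * ∫ x, w x ^ 2 := by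
  by_contra! hge
  refine hne (le_antisymm ?_ (h.le_of_forall_mul_le_oscEnergy fun w hw => nuBottom_mul_le hw))
  obtain ⟨n, hn⟩ := h.exists_ne_zero
  refine le_csInf ⟨_, p n, h.isTestFun n, hn, rfl⟩ ?_
  rintro _ ⟨w, hw, hw0, rfl⟩
  rw [hw.rayleigh_eq, le_div_iff₀ (hw.integral_sq_pos hw0)]
  exact hge w hw

/-- The spectral gap inequality on the span of a test function and the limit function. -/
lemma spectral_gap_linearComb (h : IsFormLimit R μ ν ψ p) (hμ : 0 < μ)
    {w : EuclideanSpace ℝ (Fin d) → ℝ} (hw : IsTestFun d R w) {a b : ℝ}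
    (hab : a * (∫ x, w x * Real.exp (-(μ / 2) * ‖x‖ ^ 2)) +
      b * ∫ x, ψ x * Real.exp (-(μ / 2) * ‖x‖ ^ 2) = 0) :
    (d + 2) * μ * (a ^ 2 * (∫ x, w x ^ 2) + 2 * a * b * (∫ x, w x * ψ x) +
      b ^ 2 * ∫ x, ψ x ^ 2) ≤
    a ^ 2 * oscEnergy μ w w + 2 * a * b * (ν * ∫ x, w x * ψ x) + b ^ 2 * (ν * ∫ x, ψ x ^ 2) := by
  have hwc := hw.1.continuous
  have hl := continuous_lapl hw.1
  have hgap : ∀ n, (d + 2) * μ * (a ^ 2 * (∫ x, w x ^ 2) + 2 * a * b * (∫ x, p n x * w x) +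
      b ^ 2 * ∫ x, p n x ^ 2) ≤
      a ^ 2 * oscEnergy μ w w +
        2 * a * b * (∫ x, p n x * (-lapl w x + μ ^ 2 * ‖x‖ ^ 2 * w x)) +
        b ^ 2 * (∫ x, p n x * ((ν - μ ^ 2 * ‖x‖ ^ 2) * ψ x + μ ^ 2 * ‖x‖ ^ 2 * p n x)) +
      2 * μ * (a * (∫ x, w x * Real.exp (-(μ / 2) * ‖x‖ ^ 2)) +
        b * ∫ x, p n x * Real.exp (-(μ / 2) * ‖x‖ ^ 2)) ^ 2 /
        ∫ x : EuclideanSpace ℝ (Fin d), Real.exp (-μ * ‖x‖ ^ 2) := by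
    intro n
    have hp := h.isTestFun n
    have hu := hw.linearComb hp a b
    have := oscillator_spectral_gap hμ hu.contDiff_one hu.2.1
    rw [integral_mul_linearComb hw hp (by fun_prop), integral_sq_linearComb hw hp,
      oscEnergy_linearComb μ hw hp, oscEnergy_comm μ w (p n),
      oscEnergy_eq_integral_mul μ hp.contDiff_one hp.2.1 hw.1] at this
    simp only [mul_comm (w _) (p n _)] at this
    have hb := mul_le_mul_of_nonneg_left (h.oscEnergy_le n) (sq_nonneg b)
    linarith
  have hL := ((tendsto_const_nhds (x := a ^ 2 * ∫ x, w x ^ 2)).add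
    ((h.tendsto_integral_mul hwc).const_mul (2 * a * b))).add
    (h.tendsto_integral_sq.const_mul (b ^ 2)) |>.const_mul ((d + 2) * μ)
  have hR := (((tendsto_const_nhds (x := a ^ 2 * oscEnergy μ w w)).add
    ((h.tendsto_integral_mul (q := fun x => -lapl w x + μ ^ 2 * ‖x‖ ^ 2 * w x)
      (by fun_prop)).const_mul (2 * a * b))).add
    (h.tendsto_energy_bound.const_mul (b ^ 2))).add
    (((((tendsto_const_nhds (x := a * ∫ x, w x * Real.exp (-(μ / 2) * ‖x‖ ^ 2))).add
      ((h.tendsto_integral_mul (q := fun x => Real.exp (-(μ / 2) * ‖x‖ ^ 2))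
        (by fun_prop)).const_mul b)).pow 2).const_mul (2 * μ)).div_const
      (∫ x : EuclideanSpace ℝ (Fin d), Real.exp (-μ * ‖x‖ ^ 2)))
  have key := le_of_tendsto_of_tendsto' hL hR hgap
  rw [hab, h.weak w hw] at key
  simp only [mul_comm (ψ _) (w _)] at key
  linarith [show 2 * μ * (0 : ℝ) ^ 2 / ∫ x : EuclideanSpace ℝ (Fin d), Real.exp (-μ * ‖x‖ ^ 2)
    = 0 by simp]

lemma integral_sq_linearComb_nonneg (h : IsFormLimit R μ ν ψ p)
    {w : EuclideanSpace ℝ (Fin d) → ℝ} (hw : IsTestFun d R w) (a b : ℝ) :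
    0 ≤ a ^ 2 * (∫ x, w x ^ 2) + 2 * a * b * (∫ x, w x * ψ x) + b ^ 2 * ∫ x, ψ x ^ 2 := by
  have hL := ((tendsto_const_nhds (x := a ^ 2 * ∫ x, w x ^ 2)).add
    ((h.tendsto_integral_mul hw.1.continuous).const_mul (2 * a * b))).add
    (h.tendsto_integral_sq.const_mul (b ^ 2))
  simp only [mul_comm (w _) (ψ _)]
  refine ge_of_tendsto' hL fun n => ?_
  simp only [mul_comm (p n _) (w _)]
  rw [← integral_sq_linearComb hw (h.isTestFun n)]
  exact integral_nonneg fun x => sq_nonneg _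

theorem le_of_ne_nuBottom (h : IsFormLimit R μ ν ψ p) (hμ : 0 < μ) (hne : ν ≠ nuBottom d R μ) :
    (d + 2) * μ ≤ ν := by
  obtain ⟨w, hw, hlt⟩ := h.exists_oscEnergy_lt hne
  obtain ⟨a, b, hab, horth⟩ := exists_ne_zero_linear_relation
    (∫ x, w x * Real.exp (-(μ / 2) * ‖x‖ ^ 2)) (∫ x, ψ x * Real.exp (-(μ / 2) * ‖x‖ ^ 2))
  have hgap := h.spectral_gap_linearComb hμ hw horth
  have hnn := h.integral_sq_linearComb_nonneg hw a b
  have hdef : 0 ≤ a ^ 2 * (ν * (∫ x, w x ^ 2) - oscEnergy μ w w) :=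
    mul_nonneg (sq_nonneg a) (sub_pos.mpr hlt).le
  rcases hnn.eq_or_lt with h0 | hpos
  · have ha : a = 0 := by
      by_contra ha
      have : 0 < a ^ 2 * (ν * (∫ x, w x ^ 2) - oscEnergy μ w w) :=
        mul_pos (by positivity) (sub_pos.mpr hlt)
      have hν := congrArg (fun t => ν * t) h0
      simp only [mul_zero] at hν
      rw [← h0, mul_zero] at hgap
      linarith
    subst ha
    have hb : b ≠ 0 := by simpa using hab
    have := mul_pos (sq_pos_of_ne_zero hb) h.integral_sq_pos
    simp at h0
    rcases h0 with h0 | h0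
    · exact absurd h0 hb
    · exact absurd h0 h.integral_sq_pos.ne'
  · refine le_of_mul_le_mul_right ?_ hpos
    linarith

end IsFormLimit

/-- A Dirichlet eigenfunction, extended by zero, is a form limit of its smooth truncations. -/
lemma IsDirichletEigenvalue.exists_isFormLimit (hR : 0 < R)
    (h : IsDirichletEigenvalue d R μ ν) :
    ∃ (ψ : EuclideanSpace ℝ (Fin d) → ℝ) (p : ℕ → EuclideanSpace ℝ (Fin d) → ℝ),
      IsFormLimit R μ ν ψ p := by
  obtain ⟨φ, hc, hs, ⟨x₀, hx₀, hφ₀⟩, hbd, heq⟩ := h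
  let ψ := (ball (0 : EuclideanSpace ℝ (Fin d)) R).indicator φ
  have hψ : ∀ x ∈ ball (0 : EuclideanSpace ℝ (Fin d)) R, ψ x = φ x :=
    fun x hx => indicator_of_mem hx φ
  obtain ⟨B, hB⟩ := (isCompact_closedBall (0 : EuclideanSpace ℝ (Fin d))
    R).exists_bound_of_continuousOn hc
  have hB0 : 0 ≤ B := (norm_nonneg _).trans (hB 0 (mem_closedBall_self hR.le))
  have hψB : ∀ x, |ψ x| ≤ B := fun x => by
    by_cases hx : x ∈ ball (0 : EuclideanSpace ℝ (Fin d)) R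
    · rw [hψ x hx]
      exact hB x (ball_subset_closedBall hx)
    · simpa [ψ, hx] using hB0
  obtain ⟨C, hC, htr⟩ := exists_smooth_truncation
  have happrox : ∀ ε : ℝ, 0 < ε → ∃ q, IsTestFun d R q ∧ (∀ x, |q x - ψ x| ≤ C * ε) ∧
      oscEnergy μ q q ≤ ∫ x, q x * ((ν - μ ^ 2 * ‖x‖ ^ 2) * ψ x + μ ^ 2 * ‖x‖ ^ 2 * q x) := by
    intro ε hε
    obtain ⟨χ, hχ, hχ0, hχ', hχC⟩ := htr ε hε
    have hχz : χ 0 = 0 := hχ0 0 (by simpa using hε.le)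
    have hK : IsCompact {x ∈ closedBall (0 : EuclideanSpace ℝ (Fin d)) R | ε ≤ |φ x|} :=
      (isCompact_closedBall _ _).of_isClosed_subset
        (hc.abs.preimage_isClosed_of_isClosed isClosed_closedBall isClosed_Ici) fun x hx => hx.1
    have hKR : {x ∈ closedBall (0 : EuclideanSpace ℝ (Fin d)) R | ε ≤ |φ x|} ⊆ ball 0 R := by
      rintro x ⟨hx, hxε⟩
      rcases (mem_closedBall.mp hx).eq_or_lt with h | h
      · rw [hbd x h, abs_zero] at hxε
        exact absurd hxε hε.not_ge
      · exact h
    obtain ⟨Φ, hΦ, hΦK, hΦψ⟩ := exists_isTestFun_eventuallyEq hR hs hK hKR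
    have hsmall : ∀ x, |ψ x| < ε → χ (Φ x) = 0 := fun x hx => hχ0 _ ((hΦψ x).trans hx.le)
    have hlarge : ∀ x, ε ≤ |ψ x| → x ∈ ball (0 : EuclideanSpace ℝ (Fin d)) R ∧ Φ =ᶠ[nhds x] φ := by
      intro x hx
      have hxR : x ∈ ball (0 : EuclideanSpace ℝ (Fin d)) R := by
        by_contra hxR
        simp only [ψ, indicator_of_notMem hxR, abs_zero] at hx
        exact hε.not_ge hx
      rw [hψ x hxR] at hx
      exact ⟨hxR, hΦK x ⟨ball_subset_closedBall hxR, hx⟩⟩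
    refine ⟨χ ∘ Φ, ⟨hχ.comp hΦ.1, hΦ.2.1.comp_left hχz,
      (closure_mono (Function.support_comp_subset hχz Φ)).trans hΦ.2.2⟩, fun x => ?_,
      (oscEnergy_comp_self_le μ hχ hχ' hχz hΦ.1 hΦ.2.1).trans_eq ?_⟩
    · have hcomp : χ (Φ x) = χ (ψ x) := by
        rcases lt_or_ge |ψ x| ε with hx | hx
        · rw [hsmall x hx, hχ0 _ hx.le]
        · obtain ⟨hxR, hx'⟩ := hlarge x hx
          rw [hx'.eq_of_nhds, hψ x hxR]
      rw [Function.comp, hcomp]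
      exact hχC _
    · refine integral_congr_ae (Eventually.of_forall fun x => ?_)
      simp only [Function.comp]
      rcases lt_or_ge |ψ x| ε with hx | hx
      · rw [hsmall x hx, zero_mul, zero_mul]
      · obtain ⟨hxR, hx'⟩ := hlarge x hx
        rw [lapl_congr hx', hψ x hxR]
        linear_combination χ (Φ x) * heq x hxR
  choose q hq hqψ hqE using fun n : ℕ => happrox (1 / ((n : ℝ) + 1)) Nat.one_div_pos_of_nat
  have hlim : ∀ x, Tendsto (fun n => q n x) atTop (nhds (ψ x)) := fun x => by
    rw [tendsto_iff_norm_sub_tendsto_zero]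
    refine squeeze_zero (fun _ => norm_nonneg _) (fun n => hqψ n x) ?_
    simpa using (tendsto_one_div_add_atTop_nhds_zero_nat (𝕜 := ℝ)).const_mul C
  have hqB : ∀ n x, |q n x| ≤ C + B := fun n x => by
    have h1 : (1 : ℝ) / (n + 1) ≤ 1 := by
      rw [div_le_one (by positivity)]
      linarith [n.cast_nonneg (α := ℝ)]
    have h2 := (hqψ n x).trans (mul_le_of_le_one_right hC h1)
    calc |q n x| = |(q n x - ψ x) + ψ x| := by ring_nf
      _ ≤ C + B := (abs_add_le _ _).trans (add_le_add h2 (hψB x))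
  refine ⟨ψ, q, hq, ⟨C + B, hqB⟩, hlim, hqE, fun w hw => ?_, ?_⟩
  · obtain ⟨Φ, hΦ, hΦK, -⟩ := exists_isTestFun_eventuallyEq hR hs hw.2.1.isCompact hw.2.2
    have hloc : ∀ x ∈ tsupport w, Φ x = ψ x := fun x hx => by
      rw [(hΦK x hx).eq_of_nhds, hψ x (hw.2.2 hx)]
    have hlw : ∀ x ∉ tsupport w, lapl w x = 0 := fun x hx => by
      rw [lapl_congr (v := fun _ => 0) (notMem_tsupport_iff_eventuallyEq.mp hx)]
      simp [lapl]
    calc ∫ x, ψ x * (-lapl w x + μ ^ 2 * ‖x‖ ^ 2 * w x)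
        = ∫ x, Φ x * (-lapl w x + μ ^ 2 * ‖x‖ ^ 2 * w x) := by
          refine integral_congr_ae (Eventually.of_forall fun x => ?_)
          by_cases hx : x ∈ tsupport w
          · simp only [hloc x hx]
          · simp [hlw x hx, image_eq_zero_of_notMem_tsupport hx]
      _ = ∫ x, w x * (-lapl Φ x + μ ^ 2 * ‖x‖ ^ 2 * Φ x) := by
          rw [← oscEnergy_eq_integral_mul μ hΦ.contDiff_one hΦ.2.1 hw.1, oscEnergy_comm,
            oscEnergy_eq_integral_mul μ hw.contDiff_one hw.2.1 hΦ.1]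
      _ = ν * ∫ x, w x * ψ x := by
          rw [← integral_const_mul]
          refine integral_congr_ae (Eventually.of_forall fun x => ?_)
          by_cases hx : x ∈ tsupport w
          · simp only [lapl_congr (hΦK x hx), (hΦK x hx).eq_of_nhds, hψ x (hw.2.2 hx),
              heq x (hw.2.2 hx)]
            ring
          · simp [image_eq_zero_of_notMem_tsupport hx]
  · obtain ⟨Φ, hΦ, hΦK, hΦψ⟩ := exists_isTestFun_eventuallyEq hR hs isCompact_singleton
      (singleton_subset_iff.mpr hx₀)
    have hΦ0 : Φ ≠ 0 := fun h => hφ₀ <| by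
      rw [← (hΦK x₀ rfl).eq_of_nhds, h, Pi.zero_apply]
    have hm : AEStronglyMeasurable ψ volume := aestronglyMeasurable_of_tendsto_ae atTop
      (fun n => (hq n).1.continuous.aestronglyMeasurable) (Eventually.of_forall hlim)
    have hψi : Integrable fun x => ψ x ^ 2 := by
      refine Integrable.mono' (g := (ball (0 : EuclideanSpace ℝ (Fin d)) R).indicator
        fun _ => B ^ 2) ((integrable_indicator_iff measurableSet_ball).mpr
          (integrableOn_const measure_ball_lt_top.ne)) (hm.pow 2)
        (Eventually.of_forall fun x => ?_)
      by_cases hx : x ∈ ball (0 : EuclideanSpace ℝ (Fin d)) R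
      · rw [indicator_of_mem hx, norm_pow]
        exact pow_le_pow_left₀ (norm_nonneg _) (hψB x) 2
      · simp [ψ, hx]
    refine (hΦ.integral_sq_pos hΦ0).trans_le (integral_mono ?_ hψi fun x => ?_)
    · simpa [sq] using integrable_mul_of_hasCompactSupport hΦ.1.continuous hΦ.2.1 hΦ.1.continuous
    · exact sq_le_sq.mpr (hΦψ x)

end Eigenfunction

/-- For every `μ > 0` and every linearly independent pair
`w₁, w₂ ∈ C_c^∞(B_R)`, the supremum of the Rayleigh quotient over nonzero linear
combinations of `w₁, w₂` is at least `(d+2)μ`.  Consequently, every Dirichlet eigenvalue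
`ν` of `−Δ + μ²‖x‖²` on `B_R` distinct from the smallest one satisfies `ν − dμ ≥ 2μ`. -/
theorem statement17 (d : ℕ) (hd : 1 ≤ d) (R : ℝ) (hR : 0 < R) (μ : ℝ) (hμ : 0 < μ) :
    (∀ w₁ w₂ : EuclideanSpace ℝ (Fin d) → ℝ,
      IsTestFun d R w₁ → IsTestFun d R w₂ →
      LinearIndependent ℝ ![w₁, w₂] →
      ((d : ℝ) + 2) * μ ≤
        sSup {ν : ℝ | ∃ a b : ℝ, a • w₁ + b • w₂ ≠ 0 ∧ ν = rayleigh d R μ (a • w₁ + b • w₂)}) ∧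
    ∀ ν : ℝ, IsDirichletEigenvalue d R μ ν → ν ≠ nuBottom d R μ →
      2 * μ ≤ ν - d * μ := by
  refine ⟨fun w₁ w₂ h₁ h₂ hli => le_sSup_rayleigh_linearComb hμ h₁ h₂ hli, fun ν hν hne => ?_⟩
  obtain ⟨ψ, p, hp⟩ := hν.exists_isFormLimit hR
  linarith [hp.le_of_ne_nuBottom hμ hne]
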